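/- Proposition 2. Under Assumptions 1–9, the feasible least-squares estimator θ̂ = (Σ_{t=1}^T X̂_tᵀ·X̂_t)^{−1}·Σ_{t=1}^T X̂_tᵀ·y_t of the factor network autoregressive model — where X̂_t is built from the estimated factors F̂_{t−1} in place of the true factors F_{t−1}, and assuming in addition that (T^{−1}·Σ_t X̂_tᵀ·X̂_t)^{−1} exists with probability approaching one and is O_p(1) — satisfies θ̂ − θ* → 0 in probability as m, T → ∞, where θ* = (βᵀ·Ĵ_r, ρ_1, …, ρ_N, α_1, …, α_N)ᵀ and Ĵ_r is the r×r diagonal ±1 matrix from Proposition 1. -/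

import Mathlib

open MeasureTheory Matrix ProbabilityTheory

/-- Frobenius norm of a real matrix. -/
noncomputable def frobNorm {a b : Type*} [Fintype a] [Fintype b]
    (A : Matrix a b ℝ) : ℝ :=
  Real.sqrt (∑ i, ∑ j, (A i j) ^ 2)

/-- Squared Frobenius norm. -/
def fsq {a b : Type*} [Fintype a] [Fintype b] (A : Matrix a b ℝ) : ℝ :=
  ∑ i, ∑ j, (A i j) ^ 2

section Lin
variable {a b c : Type*} [Fintype a] [Fintype b] [Fintype c]

lemma fsq_nonneg (A : Matrix a b ℝ) : 0 ≤ fsq A :=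
  Finset.sum_nonneg fun _ _ => Finset.sum_nonneg fun _ _ => sq_nonneg _

lemma frobNorm_sq (A : Matrix a b ℝ) : frobNorm A ^ 2 = fsq A :=
  Real.sq_sqrt (fsq_nonneg A)

lemma fsq_mul_le (A : Matrix a b ℝ) (B : Matrix b c ℝ) : fsq (A * B) ≤ fsq A * fsq B := by
  have h : ∀ i j, ((A * B) i j) ^ 2 ≤ (∑ k, A i k ^ 2) * (∑ k, B k j ^ 2) := fun i j => by
    rw [Matrix.mul_apply]
    exact Finset.sum_mul_sq_le_sq_mul_sq _ _ _
  calc fsq (A * B) ≤ ∑ i, ∑ j, (∑ k, A i k ^ 2) * (∑ k, B k j ^ 2) :=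
        Finset.sum_le_sum fun i _ => Finset.sum_le_sum fun j _ => h i j
    _ = (∑ i, ∑ k, A i k ^ 2) * (∑ j, ∑ k, B k j ^ 2) := by
        rw [Finset.sum_mul_sum]
    _ = fsq A * fsq B := by
        rw [Finset.sum_comm (f := fun j k => B k j ^ 2)]; rfl

lemma fsq_add_le (A B : Matrix a b ℝ) : fsq (A + B) ≤ 2 * fsq A + 2 * fsq B := by
  unfold fsq
  simp only [Finset.mul_sum, ← Finset.sum_add_distrib]
  refine Finset.sum_le_sum fun i _ => Finset.sum_le_sum fun j _ => ?_
  simp only [Matrix.add_apply]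
  nlinarith [sq_nonneg (A i j - B i j)]

lemma fsq_transpose (A : Matrix a b ℝ) : fsq Aᵀ = fsq A := by
  unfold fsq
  rw [Finset.sum_comm]; rfl

lemma fsq_mulVec_le (A : Matrix a b ℝ) (x : b → ℝ) :
    (A *ᵥ x) ⬝ᵥ (A *ᵥ x) ≤ fsq A * (x ⬝ᵥ x) := by
  unfold fsq dotProduct
  rw [Finset.sum_mul]
  refine Finset.sum_le_sum fun i _ => ?_
  have := Finset.sum_mul_sq_le_sq_mul_sq Finset.univ (A i) x
  simp only [Matrix.mulVec, dotProduct, ← sq]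
  exact this

lemma dot_sq_le (x y : a → ℝ) : (x ⬝ᵥ y) ^ 2 ≤ (x ⬝ᵥ x) * (y ⬝ᵥ y) := by
  have := Finset.sum_mul_sq_le_sq_mul_sq Finset.univ x y
  simp only [dotProduct, ← sq]; exact this

lemma dot_self_nonneg (x : a → ℝ) : 0 ≤ x ⬝ᵥ x :=
  Finset.sum_nonneg fun _ _ => mul_self_nonneg _

lemma fsq_bilin (D : Matrix a b ℝ) (x : a → ℝ) (y : b → ℝ) :
    (x ⬝ᵥ (D *ᵥ y)) ^ 2 ≤ fsq D * ((x ⬝ᵥ x) * (y ⬝ᵥ y)) := by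
  have h1 := dot_sq_le x (D *ᵥ y)
  have h2 := fsq_mulVec_le D y
  have h3 := mul_le_mul_of_nonneg_left h2 (dot_self_nonneg x)
  nlinarith

end Lin

lemma exists_kernel_vec {r : ℕ} (C : Matrix (Fin r) (Fin r) ℝ) (j : Fin r) :
    ∃ a : Fin r → ℝ, a ≠ 0 ∧ (∀ k, j < k → a k = 0) ∧ ∀ k, k < j → (C *ᵥ a) k = 0 := by
  let C' : Matrix (Fin r) (Fin r) ℝ := Matrix.of fun k l =>
    if k < j then C k l else if k = j then 0 else (1 : Matrix (Fin r) (Fin r) ℝ) k l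
  have hdet : C'.det = 0 := Matrix.det_eq_zero_of_row_eq_zero j (fun l => by simp [C'])
  obtain ⟨a, ha, h0⟩ := Matrix.exists_mulVec_eq_zero_iff.2 hdet
  refine ⟨a, ha, fun k hk => ?_, fun k hk => ?_⟩
  · have := congrFun h0 k
    simp only [Matrix.mulVec, dotProduct, C', Matrix.of_apply, if_neg (not_lt.2 hk.le),
      if_neg hk.ne', Matrix.one_apply] at this
    simpa using this
  · have := congrFun h0 k
    simp only [Matrix.mulVec, dotProduct, C', Matrix.of_apply, if_pos hk] at this
    simpa [Matrix.mulVec, dotProduct] using this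

section Spec
variable {m r : ℕ}

lemma dot_mulVec_VV (V : Matrix (Fin m) (Fin r) ℝ) (hV : Vᵀ * V = 1) (a b : Fin r → ℝ) :
    (V *ᵥ a) ⬝ᵥ (V *ᵥ b) = a ⬝ᵥ b := by
  rw [Matrix.dotProduct_mulVec, ← Matrix.mulVec_transpose, Matrix.mulVec_mulVec, hV,
    Matrix.one_mulVec]

lemma quad_VDV (V : Matrix (Fin m) (Fin r) ℝ) (d : Fin r → ℝ) (x y : Fin m → ℝ) :
    x ⬝ᵥ ((V * Matrix.diagonal d * Vᵀ) *ᵥ y) = ∑ k, d k * ((Vᵀ *ᵥ x) k * (Vᵀ *ᵥ y) k) := by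
  rw [← Matrix.mulVec_mulVec, ← Matrix.mulVec_mulVec, Matrix.dotProduct_mulVec,
    ← Matrix.mulVec_transpose]
  simp only [dotProduct, Matrix.mulVec_diagonal]
  exact Finset.sum_congr rfl fun k _ => by ring

lemma bessel (V : Matrix (Fin m) (Fin r) ℝ) (hV : Vᵀ * V = 1) (x : Fin m → ℝ) :
    (x - V *ᵥ (Vᵀ *ᵥ x)) ⬝ᵥ (x - V *ᵥ (Vᵀ *ᵥ x)) = x ⬝ᵥ x - (Vᵀ *ᵥ x) ⬝ᵥ (Vᵀ *ᵥ x) := by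
  have h1 : x ⬝ᵥ (V *ᵥ (Vᵀ *ᵥ x)) = (Vᵀ *ᵥ x) ⬝ᵥ (Vᵀ *ᵥ x) := by
    rw [Matrix.dotProduct_mulVec, ← Matrix.mulVec_transpose]
  rw [sub_dotProduct, dotProduct_sub, dotProduct_sub, dot_mulVec_VV V hV,
    dotProduct_comm (V *ᵥ _) x, h1]
  ring

lemma quad_top (A : Matrix (Fin m) (Fin m) ℝ) (hA : Aᵀ = A)
    (Vh : Matrix (Fin m) (Fin r) ℝ) (hV : Vhᵀ * Vh = 1) (μh : Fin r → ℝ)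
    (hE : A * Vh = Vh * Matrix.diagonal μh) (hdec : Antitone μh)
    (hTop : ∀ (ν' : ℝ) (x : Fin m → ℝ), x ≠ 0 → A *ᵥ x = ν' • x → Vhᵀ *ᵥ x = 0 →
      ∀ j, ν' ≤ μh j)
    (j : Fin r) (x : Fin m → ℝ) (hx : ∀ k, k < j → (Vhᵀ *ᵥ x) k = 0) :
    x ⬝ᵥ (A *ᵥ x) ≤ μh j * (x ⬝ᵥ x) := by
  set B := Vh * Matrix.diagonal (fun k => μh j - μh k) * Vhᵀ with hB
  set M := μh j • (1 : Matrix (Fin m) (Fin m) ℝ) - (A + B) with hM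
  have hBt : Bᵀ = B := by
    simp [hB, Matrix.transpose_mul, Matrix.mul_assoc]
  have hMh : M.IsHermitian := by
    rw [Matrix.IsHermitian, Matrix.conjTranspose_eq_transpose_of_trivial, hM]
    simp [hA, hBt]
  have hVA : Vhᵀ * A = Matrix.diagonal μh * Vhᵀ := by
    have := congrArg Matrix.transpose hE
    rw [Matrix.transpose_mul, Matrix.transpose_mul, hA, Matrix.diagonal_transpose] at this
    exact this
  have hVB : Vhᵀ * B = Matrix.diagonal (fun k => μh j - μh k) * Vhᵀ := by
    rw [hB, ← Matrix.mul_assoc, ← Matrix.mul_assoc, hV, Matrix.one_mul]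
  have hVM : Vhᵀ * M = 0 := by
    rw [hM, Matrix.mul_sub, Matrix.mul_add, hVA, hVB, ← Matrix.add_mul, Matrix.diagonal_add]
    ext i k
    simp [Matrix.diagonal_mul]
  have hpsd : M.PosSemidef := by
    rw [hMh.posSemidef_iff_eigenvalues_nonneg]
    intro i
    by_contra hneg
    have hneg : hMh.eigenvalues i < 0 := not_le.1 hneg
    set u : Fin m → ℝ := ⇑(hMh.eigenvectorBasis i) with hu
    have hMu : M *ᵥ u = hMh.eigenvalues i • u := hMh.mulVec_eigenvectorBasis i
    have hu0 : u ≠ 0 := by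
      intro h0
      apply hMh.eigenvectorBasis.toBasis.ne_zero i
      ext k
      have := congrFun h0 k
      simpa [hu] using this
    have hVu : Vhᵀ *ᵥ u = 0 := by
      have h1 : Vhᵀ *ᵥ (M *ᵥ u) = 0 := by rw [Matrix.mulVec_mulVec, hVM, Matrix.zero_mulVec]
      rw [hMu, Matrix.mulVec_smul] at h1
      exact (smul_eq_zero.1 h1).resolve_left hneg.ne
    have hBu : B *ᵥ u = 0 := by
      rw [hB, ← Matrix.mulVec_mulVec, hVu, Matrix.mulVec_zero]
    have hAu : A *ᵥ u = (μh j - hMh.eigenvalues i) • u := by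
      have : M *ᵥ u = μh j • u - A *ᵥ u := by
        rw [hM, Matrix.sub_mulVec, Matrix.add_mulVec, hBu, Matrix.smul_mulVec,
          Matrix.one_mulVec, add_zero]
      rw [sub_smul, ← hMu, this]; abel
    have := hTop _ u hu0 hAu hVu j
    linarith
  have h0 : 0 ≤ x ⬝ᵥ (M *ᵥ x) := by
    have := hpsd.dotProduct_mulVec_nonneg x
    simpa using this
  have h1 : x ⬝ᵥ (M *ᵥ x) = μh j * (x ⬝ᵥ x) - x ⬝ᵥ (A *ᵥ x) - x ⬝ᵥ (B *ᵥ x) := by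
    rw [hM, Matrix.sub_mulVec, Matrix.add_mulVec, Matrix.smul_mulVec, Matrix.one_mulVec,
      dotProduct_sub, dotProduct_add, dotProduct_smul, smul_eq_mul]
    ring
  have h2 : 0 ≤ x ⬝ᵥ (B *ᵥ x) := by
    rw [hB, quad_VDV]
    refine Finset.sum_nonneg fun k _ => ?_
    rcases lt_or_ge k j with hk | hk
    · rw [hx k hk]; simp
    · exact mul_nonneg (sub_nonneg.2 (hdec hk)) (mul_self_nonneg _)
  linarith

lemma quad_low (V : Matrix (Fin m) (Fin r) ℝ) (hV : Vᵀ * V = 1) (d : Fin r → ℝ)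
    (hdec : Antitone d) (A : Matrix (Fin m) (Fin m) ℝ) (hE : A * V = V * Matrix.diagonal d)
    (j : Fin r) (a : Fin r → ℝ) (ha : ∀ k, j < k → a k = 0) :
    d j * (a ⬝ᵥ a) ≤ (V *ᵥ a) ⬝ᵥ (A *ᵥ (V *ᵥ a)) := by
  rw [Matrix.mulVec_mulVec, hE, ← Matrix.mulVec_mulVec, dot_mulVec_VV V hV]
  simp only [dotProduct, Matrix.mulVec_diagonal, Finset.mul_sum]
  refine Finset.sum_le_sum fun k _ => ?_
  rcases le_or_gt k j with hk | hk
  · have := mul_le_mul_of_nonneg_right (hdec hk) (mul_self_nonneg (a k))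
    linarith
  · rw [ha k hk]; simp

lemma quad_up (V : Matrix (Fin m) (Fin r) ℝ) (hV : Vᵀ * V = 1) (d : Fin r → ℝ)
    (hdec : Antitone d) (j : Fin r) (hd : 0 ≤ d j) (x : Fin m → ℝ)
    (hx : ∀ k, k < j → (Vᵀ *ᵥ x) k = 0) :
    x ⬝ᵥ ((V * Matrix.diagonal d * Vᵀ) *ᵥ x) ≤ d j * (x ⬝ᵥ x) := by
  rw [quad_VDV]
  have h1 : ∑ k, d k * ((Vᵀ *ᵥ x) k * (Vᵀ *ᵥ x) k) ≤ d j * ((Vᵀ *ᵥ x) ⬝ᵥ (Vᵀ *ᵥ x)) := by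
    simp only [dotProduct, Finset.mul_sum]
    refine Finset.sum_le_sum fun k _ => ?_
    rcases lt_or_ge k j with hk | hk
    · have := hx k hk
      simp only [Matrix.mulVec, dotProduct] at this
      simp only [Matrix.mulVec, dotProduct]
      rw [this]; simp
    · exact mul_le_mul_of_nonneg_right (hdec hk) (mul_self_nonneg _)
  have h2 := bessel V hV x
  have h3 := dot_self_nonneg (x - V *ᵥ (Vᵀ *ᵥ x))
  nlinarith

lemma dot_self_pos {n : ℕ} (a : Fin n → ℝ) (ha : a ≠ 0) : 0 < a ⬝ᵥ a := by
  refine lt_of_le_of_ne (dot_self_nonneg a) fun h => ha ?_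
  exact dotProduct_self_eq_zero.1 h.symm

lemma weyl (A : Matrix (Fin m) (Fin m) ℝ) (hA : Aᵀ = A)
    (Vh : Matrix (Fin m) (Fin r) ℝ) (hVh : Vhᵀ * Vh = 1) (μh : Fin r → ℝ)
    (hE : A * Vh = Vh * Matrix.diagonal μh) (hdech : Antitone μh)
    (hTop : ∀ (ν' : ℝ) (x : Fin m → ℝ), x ≠ 0 → A *ᵥ x = ν' • x → Vhᵀ *ᵥ x = 0 →
      ∀ j, ν' ≤ μh j)
    (V : Matrix (Fin m) (Fin r) ℝ) (hV : Vᵀ * V = 1) (μ : Fin r → ℝ)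
    (hdec : Antitone μ) (hpos : ∀ j, 0 ≤ μ j) (h : ℝ) (hh : 0 ≤ h)
    (hΔ : ∀ x y : Fin m → ℝ, (x ⬝ᵥ ((A - V * Matrix.diagonal μ * Vᵀ) *ᵥ y)) ^ 2
      ≤ h ^ 2 * ((x ⬝ᵥ x) * (y ⬝ᵥ y))) (j : Fin r) : |μh j - μ j| ≤ h := by
  set B := V * Matrix.diagonal μ * Vᵀ with hB
  have hΔ' : ∀ x : Fin m → ℝ, |x ⬝ᵥ (A *ᵥ x) - x ⬝ᵥ (B *ᵥ x)| ≤ h * (x ⬝ᵥ x) := by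
    intro x
    have h1 := hΔ x x
    rw [Matrix.sub_mulVec, dotProduct_sub] at h1
    apply abs_le_of_sq_le_sq _ (mul_nonneg hh (dot_self_nonneg x))
    nlinarith
  have hBV : B * V = V * Matrix.diagonal μ := by
    rw [hB, Matrix.mul_assoc, hV, Matrix.mul_one]
  rw [abs_le]
  constructor
  · obtain ⟨a, ha0, ha1, ha2⟩ := exists_kernel_vec (Vhᵀ * V) j
    have e1 := quad_low V hV μ hdec B hBV j a ha1
    have e2 := quad_top A hA Vh hVh μh hE hdech hTop j (V *ᵥ a) (fun k hk => by
      rw [Matrix.mulVec_mulVec]; exact ha2 k hk)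
    have e3 := abs_le.1 (hΔ' (V *ᵥ a))
    rw [dot_mulVec_VV V hV] at e2 e3
    have := dot_self_pos a ha0
    have : μ j * (a ⬝ᵥ a) ≤ (μh j + h) * (a ⬝ᵥ a) := by linarith [e3.1]
    linarith [le_of_mul_le_mul_right this (dot_self_pos a ha0)]
  · obtain ⟨a, ha0, ha1, ha2⟩ := exists_kernel_vec (Vᵀ * Vh) j
    have e1 := quad_low Vh hVh μh hdech A hE j a ha1
    have e2 := quad_up V hV μ hdec j (hpos j) (Vh *ᵥ a) (fun k hk => by
      rw [Matrix.mulVec_mulVec]; exact ha2 k hk)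
    have e3 := abs_le.1 (hΔ' (Vh *ᵥ a))
    rw [dot_mulVec_VV Vh hVh] at e2 e3
    have := dot_self_pos a ha0
    have : μh j * (a ⬝ᵥ a) ≤ (μ j + h) * (a ⬝ᵥ a) := by linarith [e3.2]
    linarith [le_of_mul_le_mul_right this (dot_self_pos a ha0)]

end Spec

section Spec2
variable {m r : ℕ}

/-- diagonal signs -/
noncomputable def sgnv (C : Matrix (Fin r) (Fin r) ℝ) (j : Fin r) : ℝ :=
  if 0 ≤ C j j then 1 else -1

lemma sgnv_cases (C : Matrix (Fin r) (Fin r) ℝ) (j : Fin r) :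
    sgnv C j = 1 ∨ sgnv C j = -1 := by
  unfold sgnv; split_ifs <;> simp

lemma sgnv_sq (C : Matrix (Fin r) (Fin r) ℝ) (j : Fin r) : sgnv C j * sgnv C j = 1 := by
  rcases sgnv_cases C j with h | h <;> rw [h] <;> norm_num

lemma sgnv_mul (C : Matrix (Fin r) (Fin r) ℝ) (j : Fin r) : sgnv C j * C j j = |C j j| := by
  unfold sgnv; split_ifs with h
  · rw [abs_of_nonneg h, one_mul]
  · rw [abs_of_neg (not_le.1 h)]; ring

noncomputable def Kc (r : ℕ) (κ : ℝ) : ℝ := r * (r * (8 * κ + (4 * r + 2) ^ 2)) + 8 * r * r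

lemma davis_kahan (A : Matrix (Fin m) (Fin m) ℝ)
    (Vh : Matrix (Fin m) (Fin r) ℝ) (hVh : Vhᵀ * Vh = 1) (μh : Fin r → ℝ)
    (hE : A * Vh = Vh * Matrix.diagonal μh)
    (V : Matrix (Fin m) (Fin r) ℝ) (hV : Vᵀ * V = 1) (μ : Fin r → ℝ)
    (g e : ℝ) (hg : 0 < g) (he : e ≤ 1 / 2)
    (hgap : ∀ i j, i ≠ j → g ≤ |μ i - μ j|) (hlow : ∀ j, g ≤ μ j)
    (hw : ∀ j, |μh j - μ j| ≤ e * g)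
    (hΔ : ∀ x y : Fin m → ℝ, (x ⬝ᵥ ((A - V * Matrix.diagonal μ * Vᵀ) *ᵥ y)) ^ 2
      ≤ (e * g) ^ 2 * ((x ⬝ᵥ x) * (y ⬝ᵥ y))) :
    (∀ i j, i ≠ j → (Vᵀ * Vh) i j ^ 2 ≤ 4 * e ^ 2) ∧
    (∀ j, (Vᵀ * Vh) j j ^ 2 ≤ 1) ∧
    (∀ j, 1 - (Vᵀ * Vh) j j ^ 2 ≤ 4 * r * e ^ 2) := by
  set B := V * Matrix.diagonal μ * Vᵀ with hB
  have hcol : ∀ j, A *ᵥ (fun a => Vh a j) = μh j • (fun a => Vh a j) := by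
    intro j
    ext a
    have := congrFun (congrFun hE a) j
    rw [Matrix.mul_diagonal, Matrix.mul_apply] at this
    simp only [Matrix.mulVec, dotProduct, Pi.smul_apply, smul_eq_mul]
    rw [this]; ring
  have hVcol : ∀ j, Vᵀ *ᵥ (fun a => Vh a j) = fun i => (Vᵀ * Vh) i j := by
    intro j; ext i; simp [Matrix.mulVec, dotProduct, Matrix.mul_apply]
  have hn : ∀ j, (fun a => Vh a j) ⬝ᵥ (fun a => Vh a j) = 1 := by
    intro j
    have := congrFun (congrFun hVh j) j
    simpa [Matrix.mul_apply, dotProduct] using this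
  have hnV : ∀ j, (fun a => V a j) ⬝ᵥ (fun a => V a j) = 1 := by
    intro j
    have := congrFun (congrFun hV j) j
    simpa [Matrix.mul_apply, dotProduct] using this
  have hμh : ∀ j, g / 2 ≤ μh j := by
    intro j
    have h1 := (abs_le.1 (hw j)).1
    have h2 := hlow j
    nlinarith
  have hoff : ∀ i j, i ≠ j → (Vᵀ * Vh) i j ^ 2 ≤ 4 * e ^ 2 := by
    intro i j hij
    have h1 := hΔ (fun a => V a i) (fun a => Vh a j)
    have h2 : (fun a => V a i) ⬝ᵥ ((A - B) *ᵥ (fun a => Vh a j))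
        = (μh j - μ i) * (Vᵀ * Vh) i j := by
      rw [Matrix.sub_mulVec, dotProduct_sub, hcol, dotProduct_smul, hB, quad_VDV, hVcol]
      have h3 : Vᵀ *ᵥ (fun a => V a i) = fun k => (1 : Matrix (Fin r) (Fin r) ℝ) k i := by
        rw [← hV]; ext k; simp [Matrix.mulVec, dotProduct, Matrix.mul_apply]
      rw [h3]
      have h4 : (fun a => V a i) ⬝ᵥ (fun a => Vh a j) = (Vᵀ * Vh) i j := by
        simp [dotProduct, Matrix.mul_apply]
      rw [h4]
      simp [Matrix.one_apply]
      ring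
    rw [h2, hn, hnV] at h1
    have h5 : g / 2 ≤ |μh j - μ i| := by
      have h6 := hgap j i hij.symm
      have h7 := hw j
      have h8 : |μ j - μ i| ≤ |μh j - μ i| + |μh j - μ j| := by
        have := abs_sub (μh j - μ i) (μh j - μ j)
        rwa [show μh j - μ i - (μh j - μ j) = μ j - μ i by ring] at this
      nlinarith
    have h6 : (g / 2) ^ 2 ≤ (μh j - μ i) ^ 2 := by
      rw [← sq_abs (μh j - μ i)]
      exact pow_le_pow_left₀ (by positivity) h5 2
    have h7 : (g / 2) ^ 2 * (Vᵀ * Vh) i j ^ 2 ≤ (g / 2) ^ 2 * (4 * e ^ 2) := by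
      have := mul_le_mul_of_nonneg_right h6 (sq_nonneg ((Vᵀ * Vh) i j))
      nlinarith
    exact le_of_mul_le_mul_left h7 (by positivity)
  have hbes : ∀ j, 1 - ∑ i, (Vᵀ * Vh) i j ^ 2 ≤ 4 * e ^ 2 ∧ ∑ i, (Vᵀ * Vh) i j ^ 2 ≤ 1 := by
    intro j
    have h1 := bessel V hV (fun a => Vh a j)
    rw [hn, hVcol] at h1
    set p := (fun a => Vh a j) - V *ᵥ (fun i => (Vᵀ * Vh) i j) with hp
    have h2 : (fun i => (Vᵀ * Vh) i j) ⬝ᵥ (fun i => (Vᵀ * Vh) i j)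
        = ∑ i, (Vᵀ * Vh) i j ^ 2 := by simp [dotProduct, sq]
    rw [h2] at h1
    have hp0 := dot_self_nonneg p
    refine ⟨?_, by linarith⟩
    rw [← h1]
    have hVp : Vᵀ *ᵥ p = 0 := by
      rw [hp, Matrix.mulVec_sub, hVcol, Matrix.mulVec_mulVec, hV, Matrix.one_mulVec, sub_self]
    have hpv : p ⬝ᵥ (fun a => Vh a j) = p ⬝ᵥ p := by
      have : (fun a => Vh a j) = p + V *ᵥ (fun i => (Vᵀ * Vh) i j) := by rw [hp]; abel
      conv_lhs => rw [this]
      rw [dotProduct_add, Matrix.dotProduct_mulVec p V, ← Matrix.mulVec_transpose, hVp,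
        zero_dotProduct, add_zero]
    have h3 := hΔ p (fun a => Vh a j)
    rw [Matrix.sub_mulVec, dotProduct_sub, hcol, dotProduct_smul, hB, quad_VDV, hVp, hn,
      hpv] at h3
    simp only [Pi.zero_apply, zero_mul, mul_zero, Finset.sum_const_zero, sub_zero, mul_one,
      smul_eq_mul] at h3
    by_contra hcon
    have hcon := not_le.1 hcon
    have hpp : 0 < p ⬝ᵥ p := lt_of_le_of_lt (by positivity) hcon
    have h4 : (g / 2) ^ 2 ≤ (μh j) ^ 2 := pow_le_pow_left₀ (by positivity) (hμh j) 2
    have h5 : (μh j) ^ 2 * (p ⬝ᵥ p) ≤ (e * g) ^ 2 := by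
      refine le_of_mul_le_mul_right ?_ hpp
      nlinarith
    have h6 : (g / 2) ^ 2 * (p ⬝ᵥ p) ≤ (g / 2) ^ 2 * (4 * e ^ 2) := by
      have := mul_le_mul_of_nonneg_right h4 hpp.le
      nlinarith
    have := le_of_mul_le_mul_left h6 (by positivity)
    linarith
  refine ⟨hoff, fun j => ?_, fun j => ?_⟩
  · exact (Finset.single_le_sum (f := fun i => (Vᵀ * Vh) i j ^ 2) (fun i _ => sq_nonneg _)
      (Finset.mem_univ j)).trans (hbes j).2
  · have h1 := (hbes j).1
    rw [← Finset.add_sum_erase _ _ (Finset.mem_univ j)] at h1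
    have h2 : ∑ i ∈ Finset.univ.erase j, (Vᵀ * Vh) i j ^ 2 ≤ (r - 1 : ℝ) * (4 * e ^ 2) := by
      have := Finset.sum_le_card_nsmul (Finset.univ.erase j)
        (fun i => (Vᵀ * Vh) i j ^ 2) (4 * e ^ 2)
        (fun i hi => hoff i j (Finset.ne_of_mem_erase hi))
      rw [Finset.card_erase_of_mem (Finset.mem_univ j), Finset.card_univ, Fintype.card_fin,
        nsmul_eq_mul, Nat.cast_sub (Nat.one_le_of_lt j.2), Nat.cast_one] at this
      exact this
    nlinarith

lemma spec_bounds
    (Vh : Matrix (Fin m) (Fin r) ℝ) (hVh : Vhᵀ * Vh = 1) (μh : Fin r → ℝ)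
    (V : Matrix (Fin m) (Fin r) ℝ) (hV : Vᵀ * V = 1) (μ : Fin r → ℝ)
    (g e κ : ℝ) (hg : 0 < g) (he0 : 0 ≤ e) (he : e ≤ 1 / 2) (hκ : 0 ≤ κ)
    (hlow : ∀ j, g ≤ μ j) (hup : ∀ j, μ j ≤ κ * g)
    (hw : ∀ j, |μh j - μ j| ≤ e * g)
    (h1 : ∀ i j, i ≠ j → (Vᵀ * Vh) i j ^ 2 ≤ 4 * e ^ 2)
    (h2 : ∀ j, (Vᵀ * Vh) j j ^ 2 ≤ 1)
    (h3 : ∀ j, 1 - (Vᵀ * Vh) j j ^ 2 ≤ 4 * r * e ^ 2) :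
    (∀ j, g / 2 ≤ μh j) ∧
    fsq (Vh - V * Matrix.diagonal (sgnv (Vᵀ * Vh))) ≤ Kc r κ * e ^ 2 ∧
    fsq (Matrix.diagonal (fun j => (Real.sqrt (μh j))⁻¹) * Vhᵀ * V
      * Matrix.diagonal (fun j => Real.sqrt (μ j)) - Matrix.diagonal (sgnv (Vᵀ * Vh)))
      ≤ Kc r κ * e ^ 2 := by
  set s := sgnv (Vᵀ * Vh) with hs
  have hμh : ∀ j, g / 2 ≤ μh j := by
    intro j
    have h1 := (abs_le.1 (hw j)).1
    have h2 := hlow j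
    nlinarith
  have hc1 : ∀ j, |(Vᵀ * Vh) j j| ≤ 1 := fun j => by
    rw [← sq_le_one_iff_abs_le_one]; exact h2 j
  have hc2 : ∀ j, 1 - |(Vᵀ * Vh) j j| ≤ 4 * r * e ^ 2 := fun j => by
    have := h3 j
    rw [← sq_abs] at this
    nlinarith [abs_nonneg ((Vᵀ * Vh) j j), hc1 j]
  refine ⟨hμh, ?_, ?_⟩
  · have hcol : ∀ j, ∑ a, (Vh - V * Matrix.diagonal s) a j ^ 2 ≤ 8 * r * e ^ 2 := by
      intro j
      have e1 : ∀ a, (Vh - V * Matrix.diagonal s) a j ^ 2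
          = Vhᵀ j a * Vh a j - 2 * s j * (Vᵀ j a * Vh a j)
            + (s j * s j) * (Vᵀ j a * V a j) := by
        intro a
        simp only [Matrix.sub_apply, Matrix.mul_diagonal, Matrix.transpose_apply]; ring
      simp only [e1]
      rw [Finset.sum_add_distrib, Finset.sum_sub_distrib, ← Finset.mul_sum, ← Finset.mul_sum,
        ← Matrix.mul_apply, ← Matrix.mul_apply, ← Matrix.mul_apply, hVh, hV, hs, sgnv_sq]
      have := sgnv_mul (Vᵀ * Vh) j
      have h4 := hc2 j
      rw [Matrix.one_apply_eq]
      nlinarith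
    unfold fsq
    rw [Finset.sum_comm]
    calc _ ≤ ∑ j : Fin r, 8 * r * e ^ 2 := Finset.sum_le_sum fun j _ => hcol j
      _ = 8 * r * r * e ^ 2 := by simp; ring
      _ ≤ Kc r κ * e ^ 2 := by
        apply mul_le_mul_of_nonneg_right _ (sq_nonneg e)
        unfold Kc
        have : 0 ≤ (r : ℝ) * (r * (8 * κ + (4 * r + 2) ^ 2)) := by positivity
        linarith
  · have hent : ∀ j k, (Matrix.diagonal (fun j => (Real.sqrt (μh j))⁻¹) * Vhᵀ * V
      * Matrix.diagonal (fun j => Real.sqrt (μ j)) - Matrix.diagonal s) j k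
      = (Real.sqrt (μh j))⁻¹ * Real.sqrt (μ k) * (Vᵀ * Vh) k j - Matrix.diagonal s j k := by
      intro j k
      rw [Matrix.sub_apply, Matrix.mul_diagonal, Matrix.mul_assoc, Matrix.diagonal_mul]
      have : (Vhᵀ * V) j k = (Vᵀ * Vh) k j := by
        simp [Matrix.mul_apply, mul_comm]
      rw [this]; ring
    have hb : ∀ j k, ((Real.sqrt (μh j))⁻¹ * Real.sqrt (μ k) * (Vᵀ * Vh) k j
        - Matrix.diagonal s j k) ^ 2 ≤ (8 * κ + (4 * r + 2) ^ 2) * e ^ 2 := by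
      intro j k
      have hmp : 0 < μh j := lt_of_lt_of_le (by positivity) (hμh j)
      have hμp : 0 < μ k := lt_of_lt_of_le hg (hlow k)
      by_cases hjk : j = k
      · subst hjk
        rw [Matrix.diagonal_apply_eq]
        set t := (Real.sqrt (μh j))⁻¹ * Real.sqrt (μ j) with ht
        have ht0 : 0 ≤ t := by positivity
        have ht2 : t ^ 2 * μh j = μ j := by
          rw [ht, mul_pow, inv_pow, Real.sq_sqrt hmp.le, Real.sq_sqrt hμp.le]
          field_simp
        have ht3 : |t ^ 2 - 1| ≤ 2 * e := by
          have h5 : (t ^ 2 - 1) * μh j = μ j - μh j := by rw [sub_mul, ht2, one_mul]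
          have h6 : |t ^ 2 - 1| * μh j ≤ 2 * e * μh j := by
            calc |t ^ 2 - 1| * μh j = |μh j - μ j| := by
                  rw [← abs_of_pos hmp, ← abs_mul, abs_of_pos hmp, h5, abs_sub_comm]
              _ ≤ e * g := hw j
              _ ≤ 2 * e * μh j := by nlinarith [hμh j]
          exact le_of_mul_le_mul_right h6 hmp
        have ht4 : |t - 1| ≤ 2 * e := by
          have : |t ^ 2 - 1| = |t - 1| * (t + 1) := by
            rw [show t ^ 2 - 1 = (t - 1) * (t + 1) by ring, abs_mul,
              abs_of_nonneg (by positivity : 0 ≤ t + 1)]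
          nlinarith [abs_nonneg (t - 1)]
        have ht5 : t ≤ 2 := by linarith [(abs_le.1 ht4).2]
        have hss := sgnv_sq (Vᵀ * Vh) j
        have hsm := sgnv_mul (Vᵀ * Vh) j
        rw [← hs] at hss hsm
        have h7 : (t * (Vᵀ * Vh) j j - s j) ^ 2 = (t * |(Vᵀ * Vh) j j| - 1) ^ 2 := by
          rw [← hsm]
          linear_combination (1 - (t * (Vᵀ * Vh) j j) ^ 2) * hss
        rw [h7]
        have h8 : |t * |(Vᵀ * Vh) j j| - 1| ≤ (4 * r + 2) * e := by
          have h9 : t * (1 - |(Vᵀ * Vh) j j|) ≤ 4 * r * e := by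
            have h10 := mul_le_mul ht5 (hc2 j) (by linarith [hc1 j]) (by norm_num)
            have h11 : (r : ℝ) * e ^ 2 ≤ r * (e * (1 / 2)) := by
              apply mul_le_mul_of_nonneg_left _ (Nat.cast_nonneg r)
              nlinarith
            nlinarith
          have h10 : 0 ≤ t * (1 - |(Vᵀ * Vh) j j|) :=
            mul_nonneg ht0 (by linarith [hc1 j])
          have h11 := abs_le.1 ht4
          have h12 : 0 ≤ (r : ℝ) * e := by positivity
          rw [abs_le]
          constructor <;> nlinarith
        calc (t * |(Vᵀ * Vh) j j| - 1) ^ 2 = |t * |(Vᵀ * Vh) j j| - 1| ^ 2 := (sq_abs _).symm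
          _ ≤ ((4 * r + 2) * e) ^ 2 := pow_le_pow_left₀ (abs_nonneg _) h8 2
          _ ≤ _ := by
            have : 0 ≤ 8 * κ * e ^ 2 := by positivity
            nlinarith
      · rw [Matrix.diagonal_apply_ne _ hjk, sub_zero, mul_pow, mul_pow, inv_pow,
          Real.sq_sqrt hmp.le, Real.sq_sqrt hμp.le]
        have h5 : (μh j)⁻¹ * μ k ≤ 2 * κ := by
          rw [inv_mul_le_iff₀ hmp]
          nlinarith [hup k, hμh j]
        have h6 := mul_le_mul h5 (h1 k j (Ne.symm hjk)) (sq_nonneg _) (by positivity)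
        have : 0 ≤ (4 * (r : ℝ) + 2) ^ 2 * e ^ 2 := by positivity
        nlinarith
    unfold fsq
    calc _ ≤ ∑ j : Fin r, ∑ k : Fin r, (8 * κ + (4 * r + 2) ^ 2) * e ^ 2 :=
          Finset.sum_le_sum fun j _ => Finset.sum_le_sum fun k _ => by
            rw [hent]; exact hb j k
      _ = r * (r * (8 * κ + (4 * r + 2) ^ 2)) * e ^ 2 := by simp; ring
      _ ≤ Kc r κ * e ^ 2 := by
        apply mul_le_mul_of_nonneg_right _ (sq_nonneg e)
        unfold Kc
        have : 0 ≤ 8 * (r : ℝ) * r := by positivity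
        linarith

lemma fsq_diag_mul_le {n : Type*} [Fintype n] (d : Fin r → ℝ) (c : ℝ) (hd : ∀ j, d j ^ 2 ≤ c)
    (X : Matrix (Fin r) n ℝ) : fsq (Matrix.diagonal d * X) ≤ c * fsq X := by
  unfold fsq
  simp only [Finset.mul_sum, Matrix.diagonal_mul, mul_pow]
  exact Finset.sum_le_sum fun i _ => Finset.sum_le_sum fun j _ =>
    mul_le_mul_of_nonneg_right (hd i) (sq_nonneg _)

/-- Combined deterministic bound for the estimated factors. -/
lemma factor_bound {n : Type*} [Fintype n]
    (Vh : Matrix (Fin m) (Fin r) ℝ) (μh : Fin r → ℝ)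
    (V : Matrix (Fin m) (Fin r) ℝ) (μ : Fin r → ℝ) (s : Fin r → ℝ) (hs : ∀ j, s j * s j = 1)
    (g e K : ℝ) (hg : 0 < g)
    (hμh : ∀ j, g / 2 ≤ μh j)
    (h1 : fsq (Vh - V * Matrix.diagonal s) ≤ K * e ^ 2)
    (h2 : fsq (Matrix.diagonal (fun j => (Real.sqrt (μh j))⁻¹) * Vhᵀ * V
      * Matrix.diagonal (fun j => Real.sqrt (μ j)) - Matrix.diagonal s) ≤ K * e ^ 2)
    (A : Matrix (Fin r) n ℝ) (B : Matrix (Fin m) n ℝ) :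
    fsq (Matrix.diagonal (fun j => (Real.sqrt (μh j))⁻¹) * Vhᵀ *
      (V * Matrix.diagonal (fun j => Real.sqrt (μ j)) * A + B) - Matrix.diagonal s * A)
      ≤ e ^ 2 * (2 * K * fsq A + 8 / g * K * fsq B) + 8 / g * fsq (Vᵀ * B) := by
  set D := Matrix.diagonal (fun j => (Real.sqrt (μh j))⁻¹) with hD
  set Q := D * Vhᵀ * V * Matrix.diagonal (fun j => Real.sqrt (μ j)) - Matrix.diagonal s with hQ
  have e1 : D * Vhᵀ * (V * Matrix.diagonal (fun j => Real.sqrt (μ j)) * A + B)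
      - Matrix.diagonal s * A
      = Q * A + D * ((Vh - V * Matrix.diagonal s)ᵀ * B + Matrix.diagonal s * (Vᵀ * B)) := by
    rw [hQ, Matrix.transpose_sub, Matrix.transpose_mul, Matrix.diagonal_transpose]
    simp only [Matrix.mul_add, Matrix.sub_mul, Matrix.mul_sub, Matrix.mul_assoc]
    abel
  rw [e1]
  have hd : ∀ j, ((Real.sqrt (μh j))⁻¹) ^ 2 ≤ 2 / g := by
    intro j
    have hmp : 0 < μh j := lt_of_lt_of_le (by positivity) (hμh j)
    rw [inv_pow, Real.sq_sqrt hmp.le, inv_le_comm₀ hmp (by positivity), inv_div]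
    exact hμh j
  have a1 := fsq_add_le (Q * A)
    (D * ((Vh - V * Matrix.diagonal s)ᵀ * B + Matrix.diagonal s * (Vᵀ * B)))
  have a2 := fsq_mul_le Q A
  have a2' := mul_le_mul_of_nonneg_right h2 (fsq_nonneg A)
  have a3 := fsq_diag_mul_le _ _ hd
    ((Vh - V * Matrix.diagonal s)ᵀ * B + Matrix.diagonal s * (Vᵀ * B))
  have a4 := fsq_add_le ((Vh - V * Matrix.diagonal s)ᵀ * B) (Matrix.diagonal s * (Vᵀ * B))
  have a5 := fsq_mul_le (Vh - V * Matrix.diagonal s)ᵀ B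
  rw [fsq_transpose] at a5
  have a5' := mul_le_mul_of_nonneg_right h1 (fsq_nonneg B)
  have a6 := fsq_diag_mul_le s 1 (fun j => by rw [sq, hs j]) (Vᵀ * B)
  have a7 : 2 / g * fsq ((Vh - V * Matrix.diagonal s)ᵀ * B + Matrix.diagonal s * (Vᵀ * B))
      ≤ 2 / g * (2 * (K * e ^ 2 * fsq B) + 2 * fsq (Vᵀ * B)) :=
    mul_le_mul_of_nonneg_left (by linarith) (by positivity)
  calc _ ≤ 2 * (K * e ^ 2 * fsq A) +
        2 * (2 / g * (2 * (K * e ^ 2 * fsq B) + 2 * fsq (Vᵀ * B))) := by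
        rw [← hD] at a3
        linarith
    _ = _ := by ring

end Spec2

section Prob
variable {Ω : Type} [MeasurableSpace Ω] {P : Measure Ω}

lemma markov_lt [IsProbabilityMeasure P] (g : Ω → ℝ) (hg : Integrable g P) (h0 : ∀ ω, 0 ≤ g ω) (B C : ℝ)
    (hB : ∫ ω, g ω ∂P ≤ B) (hC : 0 < C) : P {ω | C < g ω} ≤ ENNReal.ofReal (B / C) := by
  have h1 := mul_meas_ge_le_integral_of_nonneg (Filter.Eventually.of_forall h0) hg C
  have h2 : P {ω | C < g ω} ≤ P {ω | C ≤ g ω} := measure_mono fun ω (h : C < g ω) => h.le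
  refine h2.trans ?_
  rw [← ENNReal.ofReal_toReal (measure_ne_top P {ω | C ≤ g ω})]
  apply ENNReal.ofReal_le_ofReal
  rw [le_div_iff₀ hC]
  have : C * (P {ω | C ≤ g ω}).toReal ≤ B := h1.trans hB
  linarith

lemma op_main [IsProbabilityMeasure P] (a Z Y G : Ω → ℝ) (C ρ ε : ℝ) (hC : 0 < C) (hρ : 0 < ρ)
    (hε : 0 < ε) (ha : Integrable a P) (hZ : Integrable Z P) (hY : Integrable Y P)
    (ha0 : ∀ ω, 0 ≤ a ω) (hZ0 : ∀ ω, 0 ≤ Z ω) (hY0 : ∀ ω, 0 ≤ Y ω)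
    (ha1 : ∫ ω, a ω ∂P ≤ C * ρ) (hZ1 : ∫ ω, Z ω ∂P ≤ C) (hY1 : ∫ ω, Y ω ∂P ≤ C * ρ)
    (hG : ∀ᵐ ω ∂P, a ω ≤ 1 / 4 → G ω ≤ a ω * Z ω + Y ω) (hρε : 32 * C * ρ ≤ ε) :
    P {ω | ((4 * C / ε) ^ 2 + 4 * C / ε) * ρ < G ω} < ENNReal.ofReal ε := by
  set L := 4 * C / ε with hL
  have hL0 : 0 < L := by positivity
  have hCL : C / L = ε / 4 := by rw [hL]; field_simp
  have m1 := markov_lt a ha ha0 _ (L * ρ) ha1 (by positivity)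
  have m2 := markov_lt Z hZ hZ0 _ L hZ1 hL0
  have m3 := markov_lt Y hY hY0 _ (L * ρ) hY1 (by positivity)
  have m4 := markov_lt a ha ha0 _ (1 / 4) ha1 (by norm_num)
  rw [mul_div_mul_right _ _ hρ.ne', hCL] at m1 m3
  rw [hCL] at m2
  have m4' : P {ω | 1 / 4 < a ω} ≤ ENNReal.ofReal (ε / 8) :=
    m4.trans (ENNReal.ofReal_le_ofReal (by linarith))
  have hsub : {ω | (L ^ 2 + L) * ρ < G ω} ⊆
      ((({ω | L * ρ < a ω} ∪ {ω | L < Z ω}) ∪ {ω | L * ρ < Y ω}) ∪ {ω | 1 / 4 < a ω}) ∪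
      {ω | ¬ (a ω ≤ 1 / 4 → G ω ≤ a ω * Z ω + Y ω)} := by
    intro ω hω
    by_contra hcon
    simp only [Set.mem_union, Set.mem_ofPred_eq, not_or, not_lt, not_not] at hcon hω
    obtain ⟨⟨⟨⟨c1, c2⟩, c3⟩, c4⟩, c5⟩ := hcon
    have := c5 c4
    have := mul_le_mul c1 c2 (hZ0 ω) (by positivity)
    nlinarith
  have h0 : P {ω | ¬ (a ω ≤ 1 / 4 → G ω ≤ a ω * Z ω + Y ω)} = 0 := hG
  calc P {ω | (L ^ 2 + L) * ρ < G ω} ≤ _ := measure_mono hsub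
    _ ≤ (((ENNReal.ofReal (ε / 4) + ENNReal.ofReal (ε / 4)) + ENNReal.ofReal (ε / 4))
        + ENNReal.ofReal (ε / 8)) + 0 := by
        refine (measure_union_le _ _).trans (add_le_add ?_ h0.le)
        refine (measure_union_le _ _).trans (add_le_add ?_ m4')
        refine (measure_union_le _ _).trans (add_le_add ?_ m3)
        exact (measure_union_le _ _).trans (add_le_add m1 m2)
    _ = ENNReal.ofReal (ε / 4 + ε / 4 + ε / 4 + ε / 8) := by
        rw [add_zero, ← ENNReal.ofReal_add, ← ENNReal.ofReal_add, ← ENNReal.ofReal_add] <;>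
          positivity
    _ < ENNReal.ofReal ε := by
        rw [ENNReal.ofReal_lt_ofReal_iff hε]; linarith

lemma fsq_eq_trace {a b : Type*} [Fintype a] [Fintype b] (A : Matrix a b ℝ) :
    fsq A = (A * Aᵀ).trace := by
  simp [fsq, Matrix.trace, Matrix.mul_apply, sq]

lemma int_fsq_mul {p m n : Type*} [Fintype p] [Fintype m] [Fintype n]
    (L : Matrix p m ℝ) (A : Ω → Matrix m n ℝ) (Γ : Matrix m m ℝ)
    (h : ∀ i j, Integrable (fun ω => (A ω * (A ω)ᵀ) i j) P ∧
      ∫ ω, (A ω * (A ω)ᵀ) i j ∂P = Γ i j) :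
    Integrable (fun ω => fsq (L * A ω)) P ∧ ∫ ω, fsq (L * A ω) ∂P = (L * Γ * Lᵀ).trace := by
  have e1 : ∀ ω, fsq (L * A ω) = ∑ i, ∑ l, ∑ k, L i k * (A ω * (A ω)ᵀ) k l * L i l := by
    intro ω
    rw [fsq_eq_trace, Matrix.transpose_mul, ← Matrix.mul_assoc, Matrix.mul_assoc L]
    simp only [Matrix.trace, Matrix.diag_apply]
    refine Finset.sum_congr rfl fun i _ => ?_
    rw [Matrix.mul_apply]
    refine Finset.sum_congr rfl fun l _ => ?_
    rw [Matrix.mul_apply, Finset.sum_mul]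
    rfl
  have hintg : ∀ i l k, Integrable (fun ω => L i k * (A ω * (A ω)ᵀ) k l * L i l) P :=
    fun i l k => ((h k l).1.const_mul _).mul_const _
  simp only [e1]
  refine ⟨integrable_finsetSum _ fun i _ => integrable_finsetSum _ fun l _ =>
    integrable_finsetSum _ fun k _ => hintg i l k, ?_⟩
  rw [integral_finsetSum _ fun i _ => integrable_finsetSum _ fun l _ =>
    integrable_finsetSum _ fun k _ => hintg i l k]
  simp only [Matrix.trace, Matrix.diag_apply]
  refine Finset.sum_congr rfl fun i _ => ?_
  rw [integral_finsetSum _ fun l _ => integrable_finsetSum _ fun k _ => hintg i l k,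
    Matrix.mul_apply]
  refine Finset.sum_congr rfl fun l _ => ?_
  rw [integral_finsetSum _ fun k _ => hintg i l k, Matrix.mul_apply, Finset.sum_mul]
  refine Finset.sum_congr rfl fun k _ => ?_
  rw [integral_mul_const, integral_const_mul, (h k l).2]
  rfl

variable {m r : ℕ} {n : Type*} [Fintype n]

lemma fsq_eq_zero {a b : Type*} [Fintype a] [Fintype b] (A : Matrix a b ℝ) (h : fsq A = 0) :
    A = 0 := by
  ext i j
  unfold fsq at h
  have h1 := (Finset.sum_eq_zero_iff_of_nonneg (s := Finset.univ) (f := fun i => ∑ j, A i j ^ 2)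
    (fun _ _ => Finset.sum_nonneg fun _ _ => sq_nonneg _)).1 h i (Finset.mem_univ _)
  have h2 := (Finset.sum_eq_zero_iff_of_nonneg (s := Finset.univ) (f := fun j => A i j ^ 2)
    (fun _ _ => sq_nonneg _)).1 h1 j (Finset.mem_univ _)
  simpa using h2

lemma chi_ae (χ : Ω → Matrix (Fin m) n ℝ) (F : Ω → Matrix (Fin r) n ℝ)
    (V : Matrix (Fin m) (Fin r) ℝ) (hV : Vᵀ * V = 1) (μ : Fin r → ℝ) (hμ : ∀ j, 0 < μ j)
    (hF : ∀ ω, F ω = Matrix.diagonal (fun j => (Real.sqrt (μ j))⁻¹) * Vᵀ * χ ω)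
    (h : ∀ i j, Integrable (fun ω => (χ ω * (χ ω)ᵀ) i j) P ∧
      ∫ ω, (χ ω * (χ ω)ᵀ) i j ∂P = (V * Matrix.diagonal μ * Vᵀ) i j) :
    ∀ᵐ ω ∂P, χ ω = V * Matrix.diagonal (fun j => Real.sqrt (μ j)) * F ω := by
  obtain ⟨h1, h2⟩ := int_fsq_mul (1 - V * Vᵀ) χ _ h
  have h3 : (1 - V * Vᵀ) * (V * Matrix.diagonal μ * Vᵀ) = 0 := by
    rw [← Matrix.mul_assoc, ← Matrix.mul_assoc, Matrix.sub_mul, Matrix.mul_assoc V, hV]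
    simp
  rw [h3, Matrix.zero_mul, Matrix.trace_zero] at h2
  have h4 := (integral_eq_zero_iff_of_nonneg (fun ω => fsq_nonneg _) h1).1 h2
  filter_upwards [h4] with ω hω
  have h5 := fsq_eq_zero _ hω
  rw [Matrix.sub_mul, Matrix.one_mul, sub_eq_zero] at h5
  rw [hF]
  have h6 : Matrix.diagonal (fun j => Real.sqrt (μ j)) *
      Matrix.diagonal (fun j => (Real.sqrt (μ j))⁻¹) = 1 := by
    rw [Matrix.diagonal_mul_diagonal, ← Matrix.diagonal_one]
    congr 1; ext j
    exact mul_inv_cancel₀ (Real.sqrt_pos.2 (hμ j)).ne'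
  conv_lhs => rw [h5]
  calc V * Vᵀ * χ ω = V * (Matrix.diagonal (fun j => Real.sqrt (μ j)) *
      Matrix.diagonal (fun j => (Real.sqrt (μ j))⁻¹)) * Vᵀ * χ ω := by rw [h6, Matrix.mul_one]
    _ = _ := by simp only [Matrix.mul_assoc]

lemma fac_moment (χ : Ω → Matrix (Fin m) n ℝ) (F : Ω → Matrix (Fin r) n ℝ)
    (V : Matrix (Fin m) (Fin r) ℝ) (hV : Vᵀ * V = 1) (μ : Fin r → ℝ) (hμ : ∀ j, 0 < μ j)
    (hF : ∀ ω, F ω = Matrix.diagonal (fun j => (Real.sqrt (μ j))⁻¹) * Vᵀ * χ ω)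
    (h : ∀ i j, Integrable (fun ω => (χ ω * (χ ω)ᵀ) i j) P ∧
      ∫ ω, (χ ω * (χ ω)ᵀ) i j ∂P = (V * Matrix.diagonal μ * Vᵀ) i j) :
    Integrable (fun ω => fsq (F ω)) P ∧ ∫ ω, fsq (F ω) ∂P = r := by
  simp only [hF]
  obtain ⟨h1, h2⟩ := int_fsq_mul (Matrix.diagonal (fun j => (Real.sqrt (μ j))⁻¹) * Vᵀ) χ _ h
  refine ⟨h1, ?_⟩
  rw [h2]
  have : Matrix.diagonal (fun j => (Real.sqrt (μ j))⁻¹) * Vᵀ * (V * Matrix.diagonal μ * Vᵀ) *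
      (Matrix.diagonal (fun j => (Real.sqrt (μ j))⁻¹) * Vᵀ)ᵀ = 1 := by
    rw [Matrix.transpose_mul, Matrix.transpose_transpose, Matrix.diagonal_transpose]
    calc _ = Matrix.diagonal (fun j => (Real.sqrt (μ j))⁻¹) * (Vᵀ * V) * Matrix.diagonal μ *
          (Vᵀ * V) * Matrix.diagonal (fun j => (Real.sqrt (μ j))⁻¹) := by
          simp only [Matrix.mul_assoc]
      _ = 1 := by
        rw [hV, Matrix.mul_one, Matrix.mul_one, Matrix.diagonal_mul_diagonal,
          Matrix.diagonal_mul_diagonal, ← Matrix.diagonal_one]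
        congr 1; ext j
        have h3 := Real.sqrt_pos.2 (hμ j)
        have h4 := Real.mul_self_sqrt (hμ j).le
        field_simp
        rw [sq]; exact h4.symm
  rw [this]; simp

lemma gammaW_eq (χ E W : Ω → Matrix (Fin m) n ℝ) (F : Ω → Matrix (Fin r) n ℝ)
    (hW : ∀ ω, W ω = χ ω + E ω) (U : Matrix (Fin m) (Fin r) ℝ) (Γχ ΓE ΓW : Matrix (Fin m) (Fin m) ℝ)
    (hU : ∀ᵐ ω ∂P, χ ω = U * F ω)
    (hχ : ∀ i j, Integrable (fun ω => (χ ω * (χ ω)ᵀ) i j) P ∧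
      ∫ ω, (χ ω * (χ ω)ᵀ) i j ∂P = Γχ i j)
    (hE : ∀ i j, Integrable (fun ω => (E ω * (E ω)ᵀ) i j) P ∧
      ∫ ω, (E ω * (E ω)ᵀ) i j ∂P = ΓE i j)
    (hWW : ∀ i j, Integrable (fun ω => (W ω * (W ω)ᵀ) i j) P ∧
      ∫ ω, (W ω * (W ω)ᵀ) i j ∂P = ΓW i j)
    (hEF : ∀ i j, Integrable (fun ω => (E ω * (F ω)ᵀ) i j) P ∧
      ∫ ω, (E ω * (F ω)ᵀ) i j ∂P = 0) : ΓW = Γχ + ΓE := by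
  have hc : ∀ i j, Integrable (fun ω => ∑ k, (E ω * (F ω)ᵀ) i k * U j k) P ∧
      ∫ ω, ∑ k, (E ω * (F ω)ᵀ) i k * U j k ∂P = 0 := by
    intro i j
    have hi : ∀ k, Integrable (fun ω => (E ω * (F ω)ᵀ) i k * U j k) P :=
      fun k => (hEF i k).1.mul_const _
    refine ⟨integrable_finsetSum _ fun k _ => hi k, ?_⟩
    rw [integral_finsetSum _ fun k _ => hi k]
    refine Finset.sum_eq_zero fun k _ => ?_
    rw [integral_mul_const, (hEF i k).2, zero_mul]
  ext i j
  rw [← (hWW i j).2, Matrix.add_apply, ← (hχ i j).2, ← (hE i j).2]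
  have hae : (fun ω => (W ω * (W ω)ᵀ) i j) =ᵐ[P] fun ω =>
      ((χ ω * (χ ω)ᵀ) i j + (E ω * (E ω)ᵀ) i j) +
      ((∑ k, (E ω * (F ω)ᵀ) i k * U j k) + ∑ k, (E ω * (F ω)ᵀ) j k * U i k) := by
    filter_upwards [hU] with ω hω
    have e1 : ∀ i j, (∑ k, (E ω * (F ω)ᵀ) i k * U j k) = (E ω * (χ ω)ᵀ) i j := by
      intro i j
      rw [hω, Matrix.transpose_mul, ← Matrix.mul_assoc, Matrix.mul_apply (N := Uᵀ)]
      rfl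
    rw [e1, e1, hW, Matrix.transpose_add, Matrix.mul_add, Matrix.add_mul, Matrix.add_mul]
    have e2 : (E ω * (χ ω)ᵀ) j i = (χ ω * (E ω)ᵀ) i j := by
      simp [Matrix.mul_apply, mul_comm]
    rw [e2]
    simp only [Matrix.add_apply]
    ring
  have g1 := integral_add (hχ i j).1 (hE i j).1
  have g2 := integral_add (hc i j).1 (hc j i).1
  have g3 := integral_add ((hχ i j).1.add (hE i j).1) ((hc i j).1.add (hc j i).1)
  simp only [Pi.add_apply] at g3
  rw [integral_congr_ae hae, g3, g1, g2, (hc i j).2, (hc j i).2]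
  ring

lemma err_bilin (E : Ω → Matrix (Fin m) n ℝ) (ΓE : Matrix (Fin m) (Fin m) ℝ) (lam : ℝ)
    (hE : ∀ i j, Integrable (fun ω => (E ω * (E ω)ᵀ) i j) P ∧
      ∫ ω, (E ω * (E ω)ᵀ) i j ∂P = ΓE i j)
    (hlam : ∀ x : Fin m → ℝ, x ⬝ᵥ ΓE.mulVec x ≤ lam * (x ⬝ᵥ x)) (x y : Fin m → ℝ) :
    (x ⬝ᵥ (ΓE *ᵥ y)) ^ 2 ≤ lam ^ 2 * ((x ⬝ᵥ x) * (y ⬝ᵥ y)) := by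
  have hsymm : ΓEᵀ = ΓE := by
    ext i j
    rw [Matrix.transpose_apply, ← (hE i j).2, ← (hE j i).2]
    congr 1; ext ω
    simp [Matrix.mul_apply, mul_comm]
  have hpos : ∀ z : Fin m → ℝ, 0 ≤ z ⬝ᵥ (ΓE *ᵥ z) := by
    intro z
    obtain ⟨_, h2⟩ := int_fsq_mul (Matrix.of fun (_ : Unit) i => z i) E ΓE hE
    have h3 : (Matrix.of (fun (_ : Unit) i => z i) * ΓE *
        (Matrix.of (fun (_ : Unit) i => z i))ᵀ).trace = z ⬝ᵥ (ΓE *ᵥ z) := by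
      rw [Matrix.mul_assoc]
      simp [Matrix.trace, Matrix.mul_apply, dotProduct, Matrix.mulVec]
    rw [← h3, ← h2]
    exact integral_nonneg fun ω => fsq_nonneg _
  have hxy : y ⬝ᵥ (ΓE *ᵥ x) = x ⬝ᵥ (ΓE *ᵥ y) := by
    rw [Matrix.dotProduct_mulVec, ← Matrix.mulVec_transpose, hsymm, dotProduct_comm]
  have hd := discrim_le_zero (a := y ⬝ᵥ (ΓE *ᵥ y)) (b := 2 * (x ⬝ᵥ (ΓE *ᵥ y)))
    (c := x ⬝ᵥ (ΓE *ᵥ x)) (fun t => by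
      have := hpos (x + t • y)
      rw [Matrix.mulVec_add, Matrix.mulVec_smul, add_dotProduct, dotProduct_add, dotProduct_add,
        smul_dotProduct, smul_dotProduct, dotProduct_smul, dotProduct_smul, hxy] at this
      simp only [smul_eq_mul] at this
      linarith)
  unfold discrim at hd
  have := mul_le_mul (hlam x) (hlam y) (hpos y) ((hpos x).trans (hlam x))
  nlinarith

lemma trace_le (ΓE : Matrix (Fin m) (Fin m) ℝ) (lam : ℝ)
    (hlam : ∀ x : Fin m → ℝ, x ⬝ᵥ ΓE.mulVec x ≤ lam * (x ⬝ᵥ x)) {k : ℕ}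
    (L : Matrix (Fin k) (Fin m) ℝ) (hL : ∀ i, L i ⬝ᵥ L i = 1) :
    (L * ΓE * Lᵀ).trace ≤ lam * k := by
  have : ∀ i, (L * ΓE * Lᵀ) i i ≤ lam := by
    intro i
    have h1 := hlam (L i)
    rw [hL i, mul_one] at h1
    have : (L * ΓE * Lᵀ) i i = L i ⬝ᵥ ΓE.mulVec (L i) := by
      rw [Matrix.mul_assoc, Matrix.mul_apply]
      simp [dotProduct, Matrix.mulVec, Matrix.mul_apply]
    rw [this]; exact h1
  calc (L * ΓE * Lᵀ).trace = ∑ i, (L * ΓE * Lᵀ) i i := rfl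
    _ ≤ ∑ i : Fin k, lam := Finset.sum_le_sum fun i _ => this i
    _ = lam * k := by simp; ring

lemma err_moments (E : Ω → Matrix (Fin m) n ℝ) (ΓE : Matrix (Fin m) (Fin m) ℝ) (lam : ℝ)
    (hE : ∀ i j, Integrable (fun ω => (E ω * (E ω)ᵀ) i j) P ∧
      ∫ ω, (E ω * (E ω)ᵀ) i j ∂P = ΓE i j)
    (hlam : ∀ x : Fin m → ℝ, x ⬝ᵥ ΓE.mulVec x ≤ lam * (x ⬝ᵥ x))
    (V : Matrix (Fin m) (Fin r) ℝ) (hV : Vᵀ * V = 1) :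
    (Integrable (fun ω => fsq (E ω)) P ∧ ∫ ω, fsq (E ω) ∂P ≤ lam * m) ∧
    (Integrable (fun ω => fsq (Vᵀ * E ω)) P ∧ ∫ ω, fsq (Vᵀ * E ω) ∂P ≤ lam * r) := by
  constructor
  · obtain ⟨h1, h2⟩ := int_fsq_mul (1 : Matrix (Fin m) (Fin m) ℝ) E ΓE hE
    simp only [Matrix.one_mul] at h1 h2
    refine ⟨h1, ?_⟩
    rw [h2]
    have := trace_le ΓE lam hlam (1 : Matrix (Fin m) (Fin m) ℝ) (fun i => by simp [dotProduct, Matrix.one_apply])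
    simpa using this
  · obtain ⟨h1, h2⟩ := int_fsq_mul Vᵀ E ΓE hE
    refine ⟨h1, ?_⟩
    rw [h2]
    refine trace_le ΓE lam hlam Vᵀ (fun i => ?_)
    have := congrFun (congrFun hV i) i
    simpa [Matrix.mul_apply, dotProduct] using this

lemma X_moment [IsProbabilityMeasure P] {p q : Type*} [Fintype p] [Fintype q] (X : Ω → Matrix p q ℝ) (M : ℝ)
    (h1 : Integrable (fun ω => frobNorm (X ω) ^ 8) P)
    (h2 : ∫ ω, frobNorm (X ω) ^ 8 ∂P ≤ M) :
    Integrable (fun ω => fsq (X ω)) P ∧ ∫ ω, fsq (X ω) ∂P ≤ M + 1 := by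
  have e1 : ∀ ω, fsq (X ω) = Real.sqrt (Real.sqrt (frobNorm (X ω) ^ 8)) := by
    intro ω
    have : frobNorm (X ω) ^ 8 = ((fsq (X ω)) ^ 2) ^ 2 := by
      rw [← frobNorm_sq]; ring
    rw [this, Real.sqrt_sq (sq_nonneg _), Real.sqrt_sq (fsq_nonneg _)]
  have hle : ∀ ω, fsq (X ω) ≤ frobNorm (X ω) ^ 8 + 1 := by
    intro ω
    have : frobNorm (X ω) ^ 8 = ((fsq (X ω)) ^ 2) ^ 2 := by
      rw [← frobNorm_sq]; ring
    rw [this]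
    nlinarith [sq_nonneg (fsq (X ω) ^ 2 - 1 / 2), sq_nonneg (fsq (X ω) - 1 / 2)]
  have hm : AEStronglyMeasurable (fun ω => fsq (X ω)) P := by
    simp only [e1]
    exact Real.continuous_sqrt.comp_aestronglyMeasurable
      (Real.continuous_sqrt.comp_aestronglyMeasurable h1.aestronglyMeasurable)
  have hi : Integrable (fun ω => frobNorm (X ω) ^ 8 + 1) P := h1.add (integrable_const 1)
  have hX : Integrable (fun ω => fsq (X ω)) P := by
    refine hi.mono' hm (Filter.Eventually.of_forall fun ω => ?_)
    rw [Real.norm_of_nonneg (fsq_nonneg _)]; exact hle ω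
  refine ⟨hX, (integral_mono hX hi hle).trans ?_⟩
  rw [integral_add h1 (integrable_const 1)]
  simpa using h2

lemma prod_moment {a b p q c : Type} [Fintype a] [Fintype b] [Fintype p] [Fintype q] [Fintype c]
    (X : Ω → Matrix p q ℝ) (nu : Ω → c → ℝ) (E : Ω → Matrix a b ℝ) {k : Type} [Fintype k]
    (L : Matrix k a ℝ)
    (hind : IndepFun (fun ω => ((fun i c => X ω i c : p → q → ℝ), (fun i => nu ω i : c → ℝ)))
      (fun ω => (fun i j => E ω i j : a → b → ℝ)) P)
    (B C : ℝ) (hB : 0 ≤ B)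
    (hX : Integrable (fun ω => fsq (X ω)) P) (hX' : ∫ ω, fsq (X ω) ∂P ≤ C)
    (hE : Integrable (fun ω => fsq (L * E ω)) P) (hE' : ∫ ω, fsq (L * E ω) ∂P ≤ B) :
    Integrable (fun ω => fsq (L * E ω) * fsq (X ω)) P ∧
      ∫ ω, fsq (L * E ω) * fsq (X ω) ∂P ≤ B * C := by
  have hφ : Measurable (fun z : (p → q → ℝ) × (c → ℝ) => ∑ i, ∑ j, (z.1 i j) ^ 2) := by fun_prop
  have hψ : Measurable (fun z : a → b → ℝ => ∑ i, ∑ j, (∑ l, L i l * z l j) ^ 2) := by fun_prop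
  have h1 := (hind.comp hφ hψ).symm
  have h2 : IndepFun (fun ω => fsq (L * E ω)) (fun ω => fsq (X ω)) P := h1
  refine ⟨h2.integrable_mul hE hX, ?_⟩
  rw [h2.integral_fun_mul_eq_mul_integral hE.aestronglyMeasurable hX.aestronglyMeasurable]
  exact mul_le_mul hE' hX' (integral_nonneg fun ω => fsq_nonneg _) hB

end Prob

section OLS

lemma avg_cs {p q : Type*} [Fintype p] [Fintype q] (T : ℕ) (A : ℕ → Matrix p q ℝ)
    (b : ℕ → p → ℝ) :
    ((T : ℝ)⁻¹ • ∑ t ∈ Finset.Icc 1 T, (A t)ᵀ *ᵥ b t) ⬝ᵥ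
      ((T : ℝ)⁻¹ • ∑ t ∈ Finset.Icc 1 T, (A t)ᵀ *ᵥ b t)
    ≤ ((T : ℝ)⁻¹ * ∑ t ∈ Finset.Icc 1 T, fsq (A t)) *
      ((T : ℝ)⁻¹ * ∑ t ∈ Finset.Icc 1 T, b t ⬝ᵥ b t) := by
  have h1 : ∀ c, ((∑ t ∈ Finset.Icc 1 T, (A t)ᵀ *ᵥ b t) c) ^ 2 ≤
      (∑ t ∈ Finset.Icc 1 T, ∑ i, A t i c ^ 2) * ∑ t ∈ Finset.Icc 1 T, b t ⬝ᵥ b t := by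
    intro c
    have h2 : (∑ t ∈ Finset.Icc 1 T, (A t)ᵀ *ᵥ b t) c
        = ∑ z ∈ Finset.Icc 1 T ×ˢ (Finset.univ : Finset p), A z.1 z.2 c * b z.1 z.2 := by
      rw [Finset.sum_product, Finset.sum_apply]
      rfl
    have h3 := Finset.sum_mul_sq_le_sq_mul_sq (Finset.Icc 1 T ×ˢ (Finset.univ : Finset p))
      (fun z => A z.1 z.2 c) (fun z => b z.1 z.2)
    rw [h2]
    refine h3.trans (le_of_eq ?_)
    rw [Finset.sum_product, Finset.sum_product]
    simp only [dotProduct, sq]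
  have h4 : (∑ t ∈ Finset.Icc 1 T, (A t)ᵀ *ᵥ b t) ⬝ᵥ (∑ t ∈ Finset.Icc 1 T, (A t)ᵀ *ᵥ b t)
      ≤ (∑ t ∈ Finset.Icc 1 T, fsq (A t)) * ∑ t ∈ Finset.Icc 1 T, b t ⬝ᵥ b t := by
    have h5 : ∑ t ∈ Finset.Icc 1 T, fsq (A t) = ∑ c, ∑ t ∈ Finset.Icc 1 T, ∑ i, A t i c ^ 2 := by
      rw [Finset.sum_comm]
      refine Finset.sum_congr rfl fun t _ => ?_
      unfold fsq; rw [Finset.sum_comm]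
    rw [h5, Finset.sum_mul, dotProduct]
    refine Finset.sum_le_sum fun c _ => ?_
    rw [← sq]; exact h1 c
  rw [smul_dotProduct, dotProduct_smul, smul_eq_mul, smul_eq_mul]
  have h6 := mul_le_mul_of_nonneg_left h4 (mul_self_nonneg ((T : ℝ)⁻¹))
  linarith

lemma dot3 {q : Type*} [Fintype q] (u v w : q → ℝ) :
    (u + v - w) ⬝ᵥ (u + v - w) ≤ 3 * (u ⬝ᵥ u + v ⬝ᵥ v + w ⬝ᵥ w) := by
  simp only [dotProduct, ← Finset.sum_add_distrib, Finset.mul_sum]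
  refine Finset.sum_le_sum fun i _ => ?_
  simp only [Pi.add_apply, Pi.sub_apply]
  nlinarith [sq_nonneg (u i - v i), sq_nonneg (u i + w i), sq_nonneg (v i + w i)]

lemma fsq_mul_diag {p q : Type*} [Fintype p] [Fintype q] [DecidableEq q] (X : Matrix p q ℝ)
    (H : q → ℝ) (hH : ∀ c, H c * H c = 1) : fsq (X * Matrix.diagonal H) = fsq X := by
  unfold fsq
  refine Finset.sum_congr rfl fun i _ => Finset.sum_congr rfl fun j _ => ?_
  rw [Matrix.mul_diagonal, mul_pow, sq (H j), hH, mul_one]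

lemma ols_bound {p q : Type*} [Fintype p] [Fintype q] [DecidableEq q] (T : ℕ) (hT : 0 < T)
    (X Xh : ℕ → Matrix p q ℝ) (H : q → ℝ) (hH : ∀ c, H c * H c = 1) (θ θs θh : q → ℝ)
    (hθs : ∀ c, θs c = H c * θ c)
    (y ν : ℕ → p → ℝ) (hy : ∀ t, 1 ≤ t → t ≤ T → y t = X t *ᵥ θ + ν t)
    (hS : IsUnit ((T : ℝ)⁻¹ • ∑ t ∈ Finset.Icc 1 T, (Xh t)ᵀ * Xh t))
    (hθh : θh = (∑ t ∈ Finset.Icc 1 T, (Xh t)ᵀ * Xh t)⁻¹ *ᵥ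
      (∑ t ∈ Finset.Icc 1 T, (Xh t)ᵀ *ᵥ y t))
    (Db Xb nb zb : ℝ) 
    (hD : (T : ℝ)⁻¹ * ∑ t ∈ Finset.Icc 1 T, fsq (Xh t - X t * Matrix.diagonal H) ≤ Db)
    (hX : (T : ℝ)⁻¹ * ∑ t ∈ Finset.Icc 1 T, fsq (X t) ≤ Xb)
    (hn : (T : ℝ)⁻¹ * ∑ t ∈ Finset.Icc 1 T, ν t ⬝ᵥ ν t ≤ nb)
    (hz : ((T : ℝ)⁻¹ • ∑ t ∈ Finset.Icc 1 T, (X t)ᵀ *ᵥ ν t) ⬝ᵥ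
      ((T : ℝ)⁻¹ • ∑ t ∈ Finset.Icc 1 T, (X t)ᵀ *ᵥ ν t) ≤ zb) :
    (θh - θs) ⬝ᵥ (θh - θs) ≤
      fsq ((T : ℝ)⁻¹ • ∑ t ∈ Finset.Icc 1 T, (Xh t)ᵀ * Xh t)⁻¹ *
        (3 * (zb + Db * nb + (2 * Db + 2 * Xb) * (Db * (θ ⬝ᵥ θ)))) := by
  set G := ∑ t ∈ Finset.Icc 1 T, (Xh t)ᵀ * Xh t with hG
  set S := (T : ℝ)⁻¹ • G with hSd
  have hT' : (T : ℝ) ≠ 0 := by positivity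
  have hSdet : IsUnit S.det := (Matrix.isUnit_iff_isUnit_det S).1 hS
  have hGdet : IsUnit G.det := by
    have : S.det = ((T : ℝ)⁻¹) ^ Fintype.card q * G.det := by rw [hSd, Matrix.det_smul]
    rw [this] at hSdet
    exact isUnit_of_mul_isUnit_right hSdet
  set D := fun t => Xh t - X t * Matrix.diagonal H with hDd
  have hθ : Matrix.diagonal H *ᵥ θs = θ := by
    ext c
    rw [Matrix.mulVec_diagonal, hθs, ← mul_assoc, hH, one_mul]
  have hθn : θs ⬝ᵥ θs = θ ⬝ᵥ θ := by
    simp only [dotProduct, hθs]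
    refine Finset.sum_congr rfl fun c _ => ?_
    linear_combination (θ c * θ c) * hH c
  have hGθ : G *ᵥ θh = ∑ t ∈ Finset.Icc 1 T, (Xh t)ᵀ *ᵥ y t := by
    rw [hθh, Matrix.mulVec_mulVec, Matrix.mul_nonsing_inv _ hGdet, Matrix.one_mulVec]
  have hGs : G *ᵥ θs = ∑ t ∈ Finset.Icc 1 T, (Xh t)ᵀ *ᵥ (Xh t *ᵥ θs) := by
    rw [hG, Matrix.sum_mulVec]
    exact Finset.sum_congr rfl fun t _ => by rw [Matrix.mulVec_mulVec]
  have hdiff : G *ᵥ (θh - θs) = (Matrix.diagonal H *ᵥ ∑ t ∈ Finset.Icc 1 T, (X t)ᵀ *ᵥ ν t)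
      + (∑ t ∈ Finset.Icc 1 T, (D t)ᵀ *ᵥ ν t)
      - ∑ t ∈ Finset.Icc 1 T, (Xh t)ᵀ *ᵥ (D t *ᵥ θs) := by
    rw [Matrix.mulVec_sub, hGθ, hGs, Matrix.mulVec_sum, ← Finset.sum_sub_distrib,
      ← Finset.sum_add_distrib, ← Finset.sum_sub_distrib]
    refine Finset.sum_congr rfl fun t ht => ?_
    rw [Finset.mem_Icc] at ht
    have e1 : X t *ᵥ θ = Xh t *ᵥ θs - D t *ᵥ θs := by
      rw [hDd, ← Matrix.sub_mulVec, sub_sub_cancel, ← Matrix.mulVec_mulVec, hθ]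
    have e2 : (Xh t)ᵀ = (D t)ᵀ + Matrix.diagonal H * (X t)ᵀ := by
      simp [hDd, Matrix.transpose_sub, Matrix.transpose_mul]
    rw [hy t ht.1 ht.2, e1, Matrix.mulVec_add, Matrix.mulVec_sub]
    have e3 : (Xh t)ᵀ *ᵥ ν t = (D t)ᵀ *ᵥ ν t + Matrix.diagonal H *ᵥ ((X t)ᵀ *ᵥ ν t) := by
      rw [e2, Matrix.add_mulVec, Matrix.mulVec_mulVec]
    rw [e3]; abel
  set u := (T : ℝ)⁻¹ • ∑ t ∈ Finset.Icc 1 T, (X t)ᵀ *ᵥ ν t with hu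
  set v := (T : ℝ)⁻¹ • ∑ t ∈ Finset.Icc 1 T, (D t)ᵀ *ᵥ ν t with hv
  set w := (T : ℝ)⁻¹ • ∑ t ∈ Finset.Icc 1 T, (Xh t)ᵀ *ᵥ (D t *ᵥ θs) with hw
  have hSdiff : S *ᵥ (θh - θs) = Matrix.diagonal H *ᵥ u + v - w := by
    rw [hSd, Matrix.smul_mulVec, hdiff, hu, hv, hw, smul_sub, smul_add, Matrix.mulVec_smul]
  have hfin : θh - θs = S⁻¹ *ᵥ (Matrix.diagonal H *ᵥ u + v - w) := by
    rw [← hSdiff, Matrix.mulVec_mulVec, Matrix.nonsing_inv_mul _ hSdet, Matrix.one_mulVec]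
  have hun : (Matrix.diagonal H *ᵥ u) ⬝ᵥ (Matrix.diagonal H *ᵥ u) = u ⬝ᵥ u := by
    simp only [dotProduct, Matrix.mulVec_diagonal]
    refine Finset.sum_congr rfl fun c _ => ?_
    linear_combination (u c * u c) * hH c
  have hTi : 0 ≤ (T : ℝ)⁻¹ := by positivity
  have hDb0 : 0 ≤ (T : ℝ)⁻¹ * ∑ t ∈ Finset.Icc 1 T, fsq (D t) :=
    mul_nonneg hTi (Finset.sum_nonneg fun t _ => fsq_nonneg _)
  have hv1 : v ⬝ᵥ v ≤ Db * nb := by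
    refine (avg_cs T D ν).trans (mul_le_mul hD hn ?_ (hDb0.trans hD))
    exact mul_nonneg hTi (Finset.sum_nonneg fun t _ => dot_self_nonneg _)
  have hw1 : w ⬝ᵥ w ≤ (2 * Db + 2 * Xb) * (Db * (θ ⬝ᵥ θ)) := by
    have hXb0 : 0 ≤ (T : ℝ)⁻¹ * ∑ t ∈ Finset.Icc 1 T, fsq (X t) :=
      mul_nonneg hTi (Finset.sum_nonneg fun t _ => fsq_nonneg _)
    refine (avg_cs T Xh (fun t => D t *ᵥ θs)).trans (mul_le_mul ?_ ?_ ?_ ?_)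
    · have : ∑ t ∈ Finset.Icc 1 T, fsq (Xh t) ≤
          2 * ∑ t ∈ Finset.Icc 1 T, fsq (D t) + 2 * ∑ t ∈ Finset.Icc 1 T, fsq (X t) := by
        rw [Finset.mul_sum, Finset.mul_sum, ← Finset.sum_add_distrib]
        refine Finset.sum_le_sum fun t _ => ?_
        have h1 := fsq_add_le (D t) (X t * Matrix.diagonal H)
        rw [fsq_mul_diag _ H hH, hDd] at h1
        simpa using h1
      have := mul_le_mul_of_nonneg_left this hTi
      linarith
    · have : ∑ t ∈ Finset.Icc 1 T, (D t *ᵥ θs) ⬝ᵥ (D t *ᵥ θs) ≤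
          (∑ t ∈ Finset.Icc 1 T, fsq (D t)) * (θ ⬝ᵥ θ) := by
        rw [Finset.sum_mul]
        refine Finset.sum_le_sum fun t _ => ?_
        rw [← hθn]; exact fsq_mulVec_le _ _
      have h1 := mul_le_mul_of_nonneg_left this hTi
      have h2 := mul_le_mul_of_nonneg_right hD (dot_self_nonneg θ)
      linarith
    · exact mul_nonneg hTi (Finset.sum_nonneg fun t _ => dot_self_nonneg _)
    · linarith
  rw [hfin]
  refine (fsq_mulVec_le _ _).trans (mul_le_mul_of_nonneg_left ?_ (fsq_nonneg _))
  refine (dot3 _ _ _).trans ?_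
  rw [hun]
  linarith

end OLS

section Design
variable {N r m : ℕ}

/-- contraction matrix for `A ×₂ yᵀ` -/
def Ym (y : Fin N → ℝ) : Matrix (Fin N × Fin N) (Fin N) ℝ :=
  Matrix.of fun z i => if z.1 = i then y z.2 else 0

lemma mul_Ym {p : Type*} (A : Matrix p (Fin N × Fin N) ℝ) (y : Fin N → ℝ) (k : p) (i : Fin N) :
    (A * Ym y) k i = ∑ j, A k (i, j) * y j := by
  rw [Matrix.mul_apply, Fintype.sum_prod_type]
  simp only [Ym, Matrix.of_apply, mul_ite, mul_zero]
  rw [Finset.sum_eq_single i]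
  · simp
  · intro b _ hb; simp [hb]
  · simp

lemma fsq_mul_Ym_le {p : Type*} [Fintype p] (A : Matrix p (Fin N × Fin N) ℝ) (y : Fin N → ℝ) :
    fsq (A * Ym y) ≤ fsq A * (y ⬝ᵥ y) := by
  unfold fsq
  rw [Finset.sum_mul]
  refine Finset.sum_le_sum fun k _ => ?_
  rw [Fintype.sum_prod_type, Finset.sum_mul]
  refine Finset.sum_le_sum fun i _ => ?_
  rw [mul_Ym]
  have := Finset.sum_mul_sq_le_sq_mul_sq Finset.univ (fun j => A k (i, j)) y
  simp only [dotProduct, ← sq]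
  exact this

/-- the design matrix -/
noncomputable def Xdes (F : Matrix (Fin r) (Fin N × Fin N) ℝ) (y : Fin N → ℝ) :
    Matrix (Fin N) (Fin r ⊕ Fin N ⊕ Fin N) ℝ := Matrix.of fun i c =>
      Sum.elim (fun k => ∑ j, F k (i, j) * y j)
        (Sum.elim (fun i' => if i = i' then y i else 0)
          (fun i' => if i = i' then (1 : ℝ) else 0)) c

lemma fsq_Xdes (F : Matrix (Fin r) (Fin N × Fin N) ℝ) (y : Fin N → ℝ) :
    fsq (Xdes F y) = fsq (F * Ym y) + y ⬝ᵥ y + N := by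
  have : fsq (F * Ym y) = ∑ i, ∑ k, (∑ j, F k (i, j) * y j) ^ 2 := by
    unfold fsq
    rw [Finset.sum_comm]
    simp only [mul_Ym]
  rw [this]
  simp only [fsq, Xdes, Matrix.of_apply, Fintype.sum_sum_type, Sum.elim_inl, Sum.elim_inr,
    Finset.sum_add_distrib, dotProduct]
  simp [sq]
  ring

lemma fsq_Xdes_diff (F Fh : Matrix (Fin r) (Fin N × Fin N) ℝ) (y : Fin N → ℝ) (s : Fin r → ℝ) :
    fsq (Xdes Fh y - Xdes F y * Matrix.diagonal (Sum.elim s (fun _ => 1)))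
      = fsq ((Fh - Matrix.diagonal s * F) * Ym y) := by
  have : fsq ((Fh - Matrix.diagonal s * F) * Ym y)
      = ∑ i, ∑ k, (∑ j, (Fh - Matrix.diagonal s * F) k (i, j) * y j) ^ 2 := by
    unfold fsq
    rw [Finset.sum_comm]
    simp only [mul_Ym]
  rw [this]
  have hmd : ∀ i c, (Xdes Fh y - Xdes F y * Matrix.diagonal (Sum.elim s (fun _ => 1)) :
        Matrix (Fin N) (Fin r ⊕ Fin N ⊕ Fin N) ℝ) i c
      = Xdes Fh y i c - Xdes F y i c * (Sum.elim s (fun _ => 1) : Fin r ⊕ Fin N ⊕ Fin N → ℝ) c :=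
    fun i c => congrArg (fun z => Xdes Fh y i c - z) (Matrix.mul_diagonal _ _ _ _)
  simp only [fsq, hmd]
  simp only [Xdes, Matrix.of_apply,
    Fintype.sum_sum_type, Sum.elim_inl, Sum.elim_inr, mul_one, sub_self]
  refine Finset.sum_congr rfl fun i _ => ?_
  simp only [ne_eq, OfNat.ofNat_ne_zero, not_false_eq_true, zero_pow, Finset.sum_const_zero,
    add_zero]
  refine Finset.sum_congr rfl fun k _ => ?_
  rw [Finset.sum_mul, ← Finset.sum_sub_distrib]
  congr 1
  refine Finset.sum_congr rfl fun j _ => ?_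
  have hd : (Matrix.diagonal s * F) k (i, j) = s k * F k (i, j) := Matrix.diagonal_mul _ _ _ _
  have hd2 : (Fh - Matrix.diagonal s * F) k (i, j)
      = Fh k (i, j) - (Matrix.diagonal s * F) k (i, j) := rfl
  rw [hd2, hd]; ring

lemma Xdes_nu (F : Matrix (Fin r) (Fin N × Fin N) ℝ) (y v : Fin N → ℝ) (i : Fin N) :
    ((Xdes F y)ᵀ *ᵥ v) (Sum.inr (Sum.inr i)) = v i := by
  simp [Matrix.mulVec, dotProduct, Xdes]

end Design

section CLT

lemma tight_fun {q : Type} [Fintype q] (L : Measure (q → ℝ)) [IsProbabilityMeasure L]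
    (ε : ℝ) (hε : 0 < ε) : ∃ K : ℝ, 0 < K ∧ ∃ f : BoundedContinuousFunction (q → ℝ) ℝ,
      (∀ x, 0 ≤ f x) ∧ (∀ x, K < x ⬝ᵥ x → f x = 1) ∧ ∫ x, f x ∂L < ε := by
  have hcont : Continuous fun x : q → ℝ => x ⬝ᵥ x := by
    unfold dotProduct; fun_prop
  let φ : ℕ → (q → ℝ) → ℝ := fun n x => max 0 (min 1 (x ⬝ᵥ x - n))
  have hφc : ∀ n, Continuous (φ n) := fun n =>
    continuous_const.max (continuous_const.min (hcont.sub continuous_const))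
  have hφ0 : ∀ n x, 0 ≤ φ n x := fun n x => le_max_left _ _
  have hφ1 : ∀ n x, φ n x ≤ 1 := fun n x => max_le zero_le_one (min_le_left _ _)
  have hb : ∀ n x, ‖φ n x‖ ≤ 1 := fun n x => by
    rw [Real.norm_of_nonneg (hφ0 n x)]; exact hφ1 n x
  have hlim : Filter.Tendsto (fun n => ∫ x, φ n x ∂L) Filter.atTop (nhds (∫ _, (0 : ℝ) ∂L)) := by
    refine tendsto_integral_of_dominated_convergence (fun _ => 1)
      (fun n => (hφc n).aestronglyMeasurable) (integrable_const 1)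
      (fun n => Filter.Eventually.of_forall (hb n)) (Filter.Eventually.of_forall fun x => ?_)
    refine tendsto_const_nhds.congr' ?_
    obtain ⟨n₀, hn₀⟩ := exists_nat_ge (x ⬝ᵥ x)
    filter_upwards [Filter.eventually_ge_atTop n₀] with n hn
    have : (n₀ : ℝ) ≤ n := by exact_mod_cast hn
    simp only [φ]
    rw [max_eq_left]
    exact (min_le_right _ _).trans (by linarith)
  rw [integral_zero] at hlim
  obtain ⟨n, hn⟩ := (hlim.eventually_lt_const hε).exists
  refine ⟨n + 1, by positivity, BoundedContinuousFunction.ofNormedAddCommGroup (φ n) (hφc n) 1 (hb n),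
    hφ0 n, fun x hx => ?_, hn⟩
  change φ n x = 1
  simp only [φ]
  rw [min_eq_left (by linarith), max_eq_right zero_le_one]

lemma clt_tail {Ω : Type} [MeasurableSpace Ω] {P : Measure Ω} [IsProbabilityMeasure P]
    {q : Type} [Fintype q] (L : Measure (q → ℝ)) [IsProbabilityMeasure L] (ε K : ℝ)
    (hε1 : ε < 1) (f : BoundedContinuousFunction (q → ℝ) ℝ)
    (h0 : ∀ x, 0 ≤ f x) (h1 : ∀ x, K < x ⬝ᵥ x → f x = 1) (h2 : ∫ x, f x ∂L < ε)
    (Z : Ω → q → ℝ)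
    (h3 : |∫ ω, (BoundedContinuousFunction.const (q → ℝ) (1 : ℝ) + f) (Z ω) ∂P
      - ∫ x, (BoundedContinuousFunction.const (q → ℝ) (1 : ℝ) + f) x ∂L| < ε) :
    P {ω | K < Z ω ⬝ᵥ Z ω} ≤ ENNReal.ofReal (2 * ε) := by
  have hfL : Integrable (fun x => f x) L := f.integrable L
  have e1 : ∫ x, (BoundedContinuousFunction.const (q → ℝ) (1 : ℝ) + f) x ∂L
      = 1 + ∫ x, f x ∂L := by
    simp only [BoundedContinuousFunction.add_apply, BoundedContinuousFunction.const_apply]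
    rw [integral_add (integrable_const 1) hfL]; simp
  have hL0 : 0 ≤ ∫ x, f x ∂L := integral_nonneg h0
  rw [e1] at h3
  simp only [BoundedContinuousFunction.add_apply, BoundedContinuousFunction.const_apply] at h3
  have hintg : Integrable (fun ω => 1 + f (Z ω)) P := by
    by_contra hni
    rw [integral_undef hni] at h3
    have := (abs_lt.1 h3).1
    linarith
  have hintg' : Integrable (fun ω => f (Z ω)) P := by
    have := hintg.sub (integrable_const (1 : ℝ))
    refine this.congr (Filter.Eventually.of_forall fun ω => ?_)
    simp
  rw [integral_add (integrable_const 1) hintg'] at h3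
  have h4 : ∫ ω, f (Z ω) ∂P ≤ 2 * ε := by
    have := (abs_lt.1 h3).2
    simp at this
    linarith
  have h5 := mul_meas_ge_le_integral_of_nonneg
    (Filter.Eventually.of_forall fun ω => h0 (Z ω)) hintg' 1
  have h6 : P {ω | K < Z ω ⬝ᵥ Z ω} ≤ P {ω | 1 ≤ f (Z ω)} :=
    measure_mono fun ω (h : K < Z ω ⬝ᵥ Z ω) => (h1 _ h).ge
  refine h6.trans ?_
  rw [← ENNReal.ofReal_toReal (measure_ne_top P {ω | 1 ≤ f (Z ω)})]
  apply ENNReal.ofReal_le_ofReal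
  rw [one_mul] at h5
  exact h5.trans h4

end CLT

section Core
variable {Ω : Type} [MeasurableSpace Ω] {P : Measure Ω} [IsProbabilityMeasure P] {N r m T : ℕ}

lemma core (hm : 0 < m) (hT : 0 < T)
    (χ E W : ℕ → Ω → Matrix (Fin m) (Fin N × Fin N) ℝ)
    (hW : ∀ t ω, W t ω = χ t ω + E t ω)
    (V : Matrix (Fin m) (Fin r) ℝ) (hV : Vᵀ * V = 1) (μ : Fin r → ℝ) (hμ : ∀ j, 0 < μ j)
    (hdec : Antitone μ)
    (hΓχ : ∀ t, t ≤ T → ∀ i j, Integrable (fun ω => (χ t ω * (χ t ω)ᵀ) i j) P ∧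
      ∫ ω, (χ t ω * (χ t ω)ᵀ) i j ∂P = (V * Matrix.diagonal μ * Vᵀ) i j)
    (F : ℕ → Ω → Matrix (Fin r) (Fin N × Fin N) ℝ)
    (hF : ∀ t ω, F t ω = Matrix.diagonal (fun j => (Real.sqrt (μ j))⁻¹) * Vᵀ * χ t ω)
    (hEF : ∀ t, t ≤ T → ∀ i j, Integrable (fun ω => (E t ω * (F t ω)ᵀ) i j) P ∧
      ∫ ω, (E t ω * (F t ω)ᵀ) i j ∂P = 0)
    (γ κ : ℝ) (hγ : 0 < γ) (hκ : 0 ≤ κ)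
    (hgap : ∀ i j, i ≠ j → γ * m ≤ |μ i - μ j|) (hlow : ∀ j, γ * m ≤ μ j)
    (hup : ∀ j, μ j ≤ κ * (γ * m))
    (ΓE : Matrix (Fin m) (Fin m) ℝ) (lam : ℝ)
    (hΓE : ∀ t, t ≤ T → ∀ i j, Integrable (fun ω => (E t ω * (E t ω)ᵀ) i j) P ∧
      ∫ ω, (E t ω * (E t ω)ᵀ) i j ∂P = ΓE i j)
    (hlam : ∀ x : Fin m → ℝ, x ⬝ᵥ ΓE.mulVec x ≤ lam * (x ⬝ᵥ x))
    (Γhat : Ω → Matrix (Fin m) (Fin m) ℝ)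
    (hΓhat : ∀ ω, Γhat ω = (T : ℝ)⁻¹ • ∑ t ∈ Finset.Icc 1 T, W t ω * (W t ω)ᵀ)
    (ΓW : Matrix (Fin m) (Fin m) ℝ)
    (hΓW : ∀ t, t ≤ T → ∀ i j, Integrable (fun ω => (W t ω * (W t ω)ᵀ) i j) P ∧
      ∫ ω, (W t ω * (W t ω)ᵀ) i j ∂P = ΓW i j)
    (R : ℝ)
    (hA6 : ∀ i j, Integrable (fun ω => (Γhat ω i j - ΓW i j) ^ 2) P ∧
      (T : ℝ) * ∫ ω, (Γhat ω i j - ΓW i j) ^ 2 ∂P ≤ R)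
    (μhat : Ω → Fin r → ℝ) (Vhat : Ω → Matrix (Fin m) (Fin r) ℝ)
    (hVhatOrth : ∀ ω, (Vhat ω)ᵀ * Vhat ω = 1)
    (hEigen : ∀ ω, Γhat ω * Vhat ω = Vhat ω * Matrix.diagonal (μhat ω))
    (hμhatDec : ∀ ω, Antitone (μhat ω))
    (hTop : ∀ ω (ν' : ℝ) (x : Fin m → ℝ), x ≠ 0 →
      (Γhat ω).mulVec x = ν' • x → (Vhat ω)ᵀ.mulVec x = 0 → ∀ j, ν' ≤ μhat ω j)
    (Fhat : ℕ → Ω → Matrix (Fin r) (Fin N × Fin N) ℝ)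
    (hFhat : ∀ t ω, Fhat t ω
      = Matrix.diagonal (fun j => (Real.sqrt (μhat ω j))⁻¹) * (Vhat ω)ᵀ * W t ω) :
    ∃ a : Ω → ℝ, Integrable a P ∧ (∀ ω, 0 ≤ a ω) ∧
      ∫ ω, a ω ∂P ≤ (2 * |R| + 2 * lam ^ 2) / γ ^ 2 * max (T : ℝ)⁻¹ (m : ℝ)⁻¹ ∧
      ∀ᵐ ω ∂P, a ω ≤ 1 / 4 → ∀ t, t ≤ T → ∀ (n : Type) [Fintype n]
        (Y : Matrix (Fin N × Fin N) n ℝ),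
        fsq ((Fhat t ω - Matrix.diagonal (sgnv (Vᵀ * Vhat ω)) * F t ω) * Y)
          ≤ a ω * (2 * Kc r κ * fsq (F t ω * Y) + 8 / (γ * m) * Kc r κ * fsq (E t ω * Y))
            + 8 / (γ * m) * fsq (Vᵀ * E t ω * Y) := by
  have hm' : (0 : ℝ) < m := by exact_mod_cast hm
  have hT' : (0 : ℝ) < T := by exact_mod_cast hT
  set g := γ * (m : ℝ) with hg
  have hg0 : 0 < g := by positivity
  have hae : ∀ t, t ≤ T → ∀ᵐ ω ∂P,
      χ t ω = V * Matrix.diagonal (fun j => Real.sqrt (μ j)) * F t ω :=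
    fun t ht => chi_ae (χ t) (F t) V hV μ hμ (hF t) (hΓχ t ht)
  have hWeq : ΓW = V * Matrix.diagonal μ * Vᵀ + ΓE :=
    gammaW_eq (χ 0) (E 0) (W 0) (F 0) (hW 0) _ _ _ _ (hae 0 (Nat.zero_le _))
      (hΓχ 0 (Nat.zero_le _)) (hΓE 0 (Nat.zero_le _)) (hΓW 0 (Nat.zero_le _))
      (hEF 0 (Nat.zero_le _))
  have hfint : Integrable (fun ω => fsq (Γhat ω - ΓW)) P :=
    integrable_finsetSum _ fun i _ => integrable_finsetSum _ fun j _ => (hA6 i j).1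
  have hfle : ∫ ω, fsq (Γhat ω - ΓW) ∂P ≤ m * (m * (|R| * (T : ℝ)⁻¹)) := by
    have e1 : ∫ ω, fsq (Γhat ω - ΓW) ∂P
        = ∑ i, ∑ j, ∫ ω, (Γhat ω i j - ΓW i j) ^ 2 ∂P := by
      change ∫ ω, ∑ i, ∑ j, (Γhat ω i j - ΓW i j) ^ 2 ∂P = _
      rw [integral_finsetSum _ fun i _ => integrable_finsetSum _ fun j _ => (hA6 i j).1]
      refine Finset.sum_congr rfl fun i _ => ?_
      rw [integral_finsetSum _ fun j _ => (hA6 i j).1]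
    rw [e1]
    calc _ ≤ ∑ i : Fin m, ∑ j : Fin m, |R| * (T : ℝ)⁻¹ := by
          refine Finset.sum_le_sum fun i _ => Finset.sum_le_sum fun j _ => ?_
          rw [← div_eq_mul_inv, le_div_iff₀ hT']
          linarith [(hA6 i j).2, le_abs_self R]
      _ = _ := by simp
  refine ⟨fun ω => (2 * fsq (Γhat ω - ΓW) + 2 * lam ^ 2) / g ^ 2,
    ((hfint.const_mul 2).add (integrable_const _)).div_const _,
    fun ω => div_nonneg (by have := fsq_nonneg (Γhat ω - ΓW); positivity) (by positivity), ?_, ?_⟩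
  · rw [integral_div, integral_add (hfint.const_mul 2) (integrable_const _), integral_const_mul]
    simp only [integral_const, probReal_univ, smul_eq_mul, one_mul]
    set ρ := max (T : ℝ)⁻¹ (m : ℝ)⁻¹
    have r1 : (T : ℝ)⁻¹ ≤ ρ := le_max_left _ _
    have r2 : (m : ℝ)⁻¹ ≤ ρ := le_max_right _ _
    rw [div_le_iff₀ (by positivity), hg]
    have e2 : (2 * |R| + 2 * lam ^ 2) / γ ^ 2 * ρ * (γ * m) ^ 2
        = (2 * |R| + 2 * lam ^ 2) * (m ^ 2 * ρ) := by field_simp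
    rw [e2]
    have h1 : (m : ℝ) ^ 2 * (T : ℝ)⁻¹ ≤ m ^ 2 * ρ := mul_le_mul_of_nonneg_left r1 (by positivity)
    have h2 : (1 : ℝ) ≤ m ^ 2 * ρ := by
      have h3 : (m : ℝ) ^ 2 * (m : ℝ)⁻¹ ≤ m ^ 2 * ρ :=
        mul_le_mul_of_nonneg_left r2 (by positivity)
      have h4 : (m : ℝ) ^ 2 * (m : ℝ)⁻¹ = m := by field_simp
      have h5 : (1 : ℝ) ≤ m := by exact_mod_cast hm
      linarith
    have h3 := mul_le_mul_of_nonneg_left h1 (by positivity : 0 ≤ 2 * |R|)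
    have h4 := mul_le_mul_of_nonneg_left h2 (by positivity : 0 ≤ 2 * lam ^ 2)
    nlinarith
  · have hall : ∀ᵐ ω ∂P, ∀ t, t ≤ T →
        χ t ω = V * Matrix.diagonal (fun j => Real.sqrt (μ j)) * F t ω := by
      rw [ae_all_iff]; intro t
      by_cases ht : t ≤ T
      · filter_upwards [hae t ht] with ω hω _ using hω
      · exact Filter.Eventually.of_forall fun ω h => absurd h ht
    filter_upwards [hall] with ω hω ha t ht n _ Y
    set h := Real.sqrt (2 * fsq (Γhat ω - ΓW) + 2 * lam ^ 2) with hh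
    have hnn : 0 ≤ 2 * fsq (Γhat ω - ΓW) + 2 * lam ^ 2 := by
      have := fsq_nonneg (Γhat ω - ΓW); positivity
    set e := h / g with he
    have hh0 : 0 ≤ h := Real.sqrt_nonneg _
    have he0 : 0 ≤ e := by positivity
    have hesq : (2 * fsq (Γhat ω - ΓW) + 2 * lam ^ 2) / g ^ 2 = e ^ 2 := by
      rw [he, div_pow, hh, Real.sq_sqrt hnn]
    rw [hesq] at ha ⊢
    have he1 : e ≤ 1 / 2 := by nlinarith
    have heg : e * g = h := by rw [he]; field_simp
    have hΔ : ∀ x y : Fin m → ℝ, (x ⬝ᵥ ((Γhat ω - V * Matrix.diagonal μ * Vᵀ) *ᵥ y)) ^ 2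
      ≤ (e * g) ^ 2 * ((x ⬝ᵥ x) * (y ⬝ᵥ y)) := by
      intro x y
      have d1 : Γhat ω - V * Matrix.diagonal μ * Vᵀ = (Γhat ω - ΓW) + ΓE := by
        rw [hWeq]; abel
      have d2 := fsq_bilin (Γhat ω - ΓW) x y
      have d3 := err_bilin (E 0) ΓE lam (hΓE 0 (Nat.zero_le _)) hlam x y
      rw [d1, Matrix.add_mulVec, dotProduct_add, heg, hh, Real.sq_sqrt hnn]
      nlinarith [sq_nonneg (x ⬝ᵥ (Γhat ω - ΓW) *ᵥ y - x ⬝ᵥ ΓE *ᵥ y)]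
    have hsym : (Γhat ω)ᵀ = Γhat ω := by
      rw [hΓhat, Matrix.transpose_smul, Matrix.transpose_sum]
      simp [Matrix.transpose_mul]
    have hw := weyl (Γhat ω) hsym (Vhat ω) (hVhatOrth ω) (μhat ω) (hEigen ω) (hμhatDec ω)
      (hTop ω) V hV μ hdec (fun j => (hμ j).le) (e * g) (by positivity) hΔ
    obtain ⟨k1, k2, k3⟩ := davis_kahan (Γhat ω) (Vhat ω) (hVhatOrth ω) (μhat ω) (hEigen ω)
      V hV μ g e hg0 he1 hgap hlow hw hΔ
    obtain ⟨b1, b2, b3⟩ := spec_bounds (Vhat ω) (hVhatOrth ω) (μhat ω) V hV μ g e κ hg0 he0 he1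
      hκ hlow hup hw k1 k2 k3
    have hfin := factor_bound (Vhat ω) (μhat ω) V μ (sgnv (Vᵀ * Vhat ω)) (sgnv_sq _) g e (Kc r κ)
      hg0 b1 b2 b3 (F t ω * Y) (E t ω * Y)
    rw [← Matrix.mul_assoc Vᵀ] at hfin
    convert hfin using 2
    rw [hFhat, hW, hω t ht, Matrix.sub_mul]
    simp only [Matrix.mul_assoc, Matrix.add_mul]

end Core

section Rate
variable {Ω : Type} [MeasurableSpace Ω] {P : Measure Ω} [IsProbabilityMeasure P] {N r m T : ℕ}

lemma avg_mom (hT : 0 < T) (g : ℕ → Ω → ℝ) (B : ℝ)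
    (hg : ∀ t ∈ Finset.Icc 1 T, Integrable (g t) P ∧ ∫ ω, g t ω ∂P ≤ B) :
    Integrable (fun ω => (T : ℝ)⁻¹ * ∑ t ∈ Finset.Icc 1 T, g t ω) P ∧
      ∫ ω, (T : ℝ)⁻¹ * ∑ t ∈ Finset.Icc 1 T, g t ω ∂P ≤ B := by
  have hT' : (0 : ℝ) < T := by exact_mod_cast hT
  refine ⟨(integrable_finsetSum _ fun t ht => (hg t ht).1).const_mul _, ?_⟩
  rw [integral_const_mul, integral_finsetSum _ fun t ht => (hg t ht).1]
  have h1 : ∑ t ∈ Finset.Icc 1 T, ∫ ω, g t ω ∂P ≤ ∑ t ∈ Finset.Icc 1 T, B :=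
    Finset.sum_le_sum fun t ht => (hg t ht).2
  rw [Finset.sum_const, Nat.card_Icc, nsmul_eq_mul] at h1
  simp only [Nat.add_sub_cancel] at h1
  rw [inv_mul_le_iff₀ hT']
  exact h1

lemma rate_scalar (hm : 0 < m) (a FX EX VX G : Ω → ℝ) (A0 K γ f e v ρ ε : ℝ)
    (hA0 : 0 ≤ A0) (hK : 0 ≤ K) (hγ : 0 < γ) (hf : 0 ≤ f) (he : 0 ≤ e) (hv : 0 ≤ v)
    (hρ : 0 < ρ) (hmρ : (m : ℝ)⁻¹ ≤ ρ) (hε : 0 < ε)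
    (ha : Integrable a P) (ha0 : ∀ ω, 0 ≤ a ω) (ha1 : ∫ ω, a ω ∂P ≤ A0 * ρ)
    (hF : Integrable FX P) (hF0 : ∀ ω, 0 ≤ FX ω) (hF1 : ∫ ω, FX ω ∂P ≤ f)
    (hE : Integrable EX P) (hE0 : ∀ ω, 0 ≤ EX ω) (hE1 : ∫ ω, EX ω ∂P ≤ e * m)
    (hV : Integrable VX P) (hV0 : ∀ ω, 0 ≤ VX ω) (hV1 : ∫ ω, VX ω ∂P ≤ v)
    (hG : ∀ᵐ ω ∂P, a ω ≤ 1 / 4 → G ω ≤ a ω * (2 * K * FX ω + 8 / (γ * m) * K * EX ω)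
      + 8 / (γ * m) * VX ω)
    (hρε : 32 * (A0 + 2 * K * f + 8 * K * e / γ + 8 * v / γ + 1) * ρ ≤ ε) :
    P {ω | ((4 * (A0 + 2 * K * f + 8 * K * e / γ + 8 * v / γ + 1) / ε) ^ 2
      + 4 * (A0 + 2 * K * f + 8 * K * e / γ + 8 * v / γ + 1) / ε) * ρ < G ω}
      < ENNReal.ofReal ε := by
  have hm' : (0 : ℝ) < m := by exact_mod_cast hm
  have p1 : 0 ≤ 2 * K * f := by positivity
  have p2 : 0 ≤ 8 * K * e / γ := by positivity
  have p3 : 0 ≤ 8 * v / γ := by positivity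
  set C := A0 + 2 * K * f + 8 * K * e / γ + 8 * v / γ + 1 with hC
  refine op_main a (fun ω => 2 * K * FX ω + 8 / (γ * m) * K * EX ω)
    (fun ω => 8 / (γ * m) * VX ω) G C ρ ε (by linarith) hρ hε ha
    ((hF.const_mul _).add (hE.const_mul _)) (hV.const_mul _) ha0 ?_ ?_ ?_ ?_ ?_ hG hρε
  · intro ω
    have := hF0 ω; have := hE0 ω; positivity
  · intro ω
    have := hV0 ω; positivity
  · exact ha1.trans (mul_le_mul_of_nonneg_right (by linarith) hρ.le)
  · rw [integral_add (hF.const_mul _) (hE.const_mul _), integral_const_mul, integral_const_mul]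
    have h1 : 2 * K * ∫ ω, FX ω ∂P ≤ 2 * K * f := mul_le_mul_of_nonneg_left hF1 (by positivity)
    have h2 : 8 / (γ * m) * K * ∫ ω, EX ω ∂P ≤ 8 / (γ * m) * K * (e * m) :=
      mul_le_mul_of_nonneg_left hE1 (by positivity)
    have h3 : 8 / (γ * m) * K * (e * m) = 8 * K * e / γ := by field_simp
    linarith
  · rw [integral_const_mul]
    have h2 : 8 / (γ * m) * ∫ ω, VX ω ∂P ≤ 8 / (γ * m) * v :=
      mul_le_mul_of_nonneg_left hV1 (by positivity)
    have h3 : 8 / (γ * m) * v = 8 * v / γ * (m : ℝ)⁻¹ := by field_simp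
    have h4 : 8 * v / γ * (m : ℝ)⁻¹ ≤ 8 * v / γ * ρ := mul_le_mul_of_nonneg_left hmρ p3
    have h5 : 8 * v / γ * ρ ≤ C * ρ := mul_le_mul_of_nonneg_right (by linarith) hρ.le
    linarith

lemma rate_design (hm : 0 < m) (hT : 0 < T) (a : Ω → ℝ) (A0 K γ lam MB ρ ε : ℝ)
    (hA0 : 0 ≤ A0) (hK : 0 ≤ K) (hγ : 0 < γ) (hlam : 0 ≤ lam) (hMB : 0 ≤ MB)
    (hρ : 0 < ρ) (hmρ : (m : ℝ)⁻¹ ≤ ρ) (hε : 0 < ε)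
    (ha : Integrable a P) (ha0 : ∀ ω, 0 ≤ a ω) (ha1 : ∫ ω, a ω ∂P ≤ A0 * ρ)
    (F Fh : ℕ → Ω → Matrix (Fin r) (Fin N × Fin N) ℝ)
    (E : ℕ → Ω → Matrix (Fin m) (Fin N × Fin N) ℝ) (V : Matrix (Fin m) (Fin r) ℝ)
    (s : Ω → Fin r → ℝ) (y ν : ℕ → Ω → Fin N → ℝ)
    (hcore : ∀ᵐ ω ∂P, a ω ≤ 1 / 4 → ∀ t, t ≤ T → ∀ (n : Type) [Fintype n]
        (Y : Matrix (Fin N × Fin N) n ℝ),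
        fsq ((Fh t ω - Matrix.diagonal (s ω) * F t ω) * Y)
          ≤ a ω * (2 * K * fsq (F t ω * Y) + 8 / (γ * m) * K * fsq (E t ω * Y))
            + 8 / (γ * m) * fsq (Vᵀ * E t ω * Y))
    (X Xh : ℕ → Ω → Matrix (Fin N) (Fin r ⊕ Fin N ⊕ Fin N) ℝ)
    (hX : ∀ t ω, X t ω = Xdes (F (t - 1) ω) (y (t - 1) ω))
    (hXh : ∀ t ω, Xh t ω = Xdes (Fh (t - 1) ω) (y (t - 1) ω))
    (hXm : ∀ t, 1 ≤ t → t ≤ T → Integrable (fun ω => fsq (X t ω)) P ∧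
      ∫ ω, fsq (X t ω) ∂P ≤ MB)
    (hEm : ∀ t, t ≤ T → (Integrable (fun ω => fsq (E t ω)) P ∧ ∫ ω, fsq (E t ω) ∂P ≤ lam * m) ∧
      (Integrable (fun ω => fsq (Vᵀ * E t ω)) P ∧ ∫ ω, fsq (Vᵀ * E t ω) ∂P ≤ lam * r))
    (hIndep : ∀ t s, 1 ≤ t → t ≤ T → s ≤ T →
      IndepFun (fun ω => ((fun i c => X t ω i c : Fin N → (Fin r ⊕ Fin N ⊕ Fin N) → ℝ),
          (fun i => ν t ω i : Fin N → ℝ)))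
        (fun ω => (fun i j => E s ω i j : Fin m → (Fin N × Fin N) → ℝ)) P)
    (hρε : 32 * (A0 + 2 * K * MB + 8 * K * (lam * MB) / γ + 8 * (lam * r * MB) / γ + 1) * ρ ≤ ε) :
    P {ω | ((4 * (A0 + 2 * K * MB + 8 * K * (lam * MB) / γ + 8 * (lam * r * MB) / γ + 1) / ε) ^ 2
      + 4 * (A0 + 2 * K * MB + 8 * K * (lam * MB) / γ + 8 * (lam * r * MB) / γ + 1) / ε) * ρ
      < (T : ℝ)⁻¹ * ∑ t ∈ Finset.Icc 1 T,
        fsq (Xh t ω - X t ω * Matrix.diagonal (Sum.elim (s ω) (fun _ => 1)))}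
      < ENNReal.ofReal ε := by
  have hT' : (0 : ℝ) < T := by exact_mod_cast hT
  have hm' : (0 : ℝ) < m := by exact_mod_cast hm
  have aF := avg_mom (P := P) hT (fun t ω => fsq (X t ω)) MB
    fun t ht => hXm t (Finset.mem_Icc.1 ht).1 (Finset.mem_Icc.1 ht).2
  have aE := avg_mom (P := P) hT (fun t ω => fsq (E (t - 1) ω) * fsq (X t ω)) (lam * m * MB)
    fun t ht => by
      have h1 := (Finset.mem_Icc.1 ht).1
      have h2 := (Finset.mem_Icc.1 ht).2
      have h3 := prod_moment (X t) (ν t) (E (t - 1)) (1 : Matrix (Fin m) (Fin m) ℝ)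
        (hIndep t (t - 1) h1 h2 (by omega)) (lam * m) MB (by positivity)
        (hXm t h1 h2).1 (hXm t h1 h2).2
      simp only [Matrix.one_mul] at h3
      exact h3 (hEm (t - 1) (by omega)).1.1 (hEm (t - 1) (by omega)).1.2
  have aV := avg_mom (P := P) hT (fun t ω => fsq (Vᵀ * E (t - 1) ω) * fsq (X t ω)) (lam * r * MB)
    fun t ht => by
      have h1 := (Finset.mem_Icc.1 ht).1
      have h2 := (Finset.mem_Icc.1 ht).2
      exact prod_moment (X t) (ν t) (E (t - 1)) Vᵀ
        (hIndep t (t - 1) h1 h2 (by omega)) (lam * r) MB (by positivity)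
        (hXm t h1 h2).1 (hXm t h1 h2).2
        (hEm (t - 1) (by omega)).2.1 (hEm (t - 1) (by omega)).2.2
  have hTi : 0 ≤ (T : ℝ)⁻¹ := by positivity
  refine rate_scalar hm a _ _ _ _ A0 K γ MB (lam * MB) (lam * r * MB) ρ ε hA0 hK hγ hMB
    (by positivity) (by positivity) hρ hmρ hε ha ha0 ha1 aF.1
    (fun ω => mul_nonneg hTi (Finset.sum_nonneg fun t _ => fsq_nonneg _)) aF.2 aE.1
    (fun ω => mul_nonneg hTi (Finset.sum_nonneg fun t _ =>
      mul_nonneg (fsq_nonneg _) (fsq_nonneg _))) (aE.2.trans (le_of_eq (by ring))) aV.1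
    (fun ω => mul_nonneg hTi (Finset.sum_nonneg fun t _ =>
      mul_nonneg (fsq_nonneg _) (fsq_nonneg _))) aV.2 ?_ hρε
  filter_upwards [hcore] with ω hω haω
  have hω' := hω haω
  have key : ∀ t ∈ Finset.Icc 1 T,
      fsq (Xh t ω - X t ω * Matrix.diagonal (Sum.elim (s ω) (fun _ => 1)))
      ≤ a ω * (2 * K * fsq (X t ω) + 8 / (γ * m) * K * (fsq (E (t - 1) ω) * fsq (X t ω)))
        + 8 / (γ * m) * (fsq (Vᵀ * E (t - 1) ω) * fsq (X t ω)) := by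
    intro t ht
    have h2 := (Finset.mem_Icc.1 ht).2
    have h3 := hω' (t - 1) (by omega) (Fin N) (Ym (y (t - 1) ω))
    have hN0 : (0 : ℝ) ≤ N := Nat.cast_nonneg N
    have q0 := fsq_Xdes (F (t - 1) ω) (y (t - 1) ω)
    have y0 : 0 ≤ y (t - 1) ω ⬝ᵥ y (t - 1) ω := dot_self_nonneg _
    have f0 := fsq_nonneg (F (t - 1) ω * Ym (y (t - 1) ω))
    rw [hXh, hX, fsq_Xdes_diff]
    refine h3.trans ?_
    have u1 : fsq (F (t - 1) ω * Ym (y (t - 1) ω)) ≤ fsq (Xdes (F (t - 1) ω) (y (t - 1) ω)) := by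
      linarith
    have u2 : fsq (E (t - 1) ω * Ym (y (t - 1) ω))
        ≤ fsq (E (t - 1) ω) * fsq (Xdes (F (t - 1) ω) (y (t - 1) ω)) :=
      (fsq_mul_Ym_le _ _).trans (mul_le_mul_of_nonneg_left (by linarith) (fsq_nonneg _))
    have u3 : fsq (Vᵀ * E (t - 1) ω * Ym (y (t - 1) ω))
        ≤ fsq (Vᵀ * E (t - 1) ω) * fsq (Xdes (F (t - 1) ω) (y (t - 1) ω)) :=
      (fsq_mul_Ym_le _ _).trans (mul_le_mul_of_nonneg_left (by linarith) (fsq_nonneg _))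
    have c1 : 0 ≤ 2 * K := by positivity
    have c2 : 0 ≤ 8 / (γ * m) * K := by positivity
    have c3 : 0 ≤ 8 / (γ * m) := by positivity
    refine add_le_add (mul_le_mul_of_nonneg_left (add_le_add ?_ ?_) (ha0 ω)) ?_
    · exact mul_le_mul_of_nonneg_left u1 c1
    · exact mul_le_mul_of_nonneg_left u2 c2
    · exact mul_le_mul_of_nonneg_left u3 c3
  refine (mul_le_mul_of_nonneg_left (Finset.sum_le_sum key) hTi).trans (le_of_eq ?_)
  rw [Finset.sum_add_distrib, ← Finset.mul_sum, Finset.sum_add_distrib, ← Finset.mul_sum,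
    ← Finset.mul_sum, ← Finset.mul_sum]
  ring

lemma nu_bound (hT : 0 < T) (F : ℕ → Matrix (Fin r) (Fin N × Fin N) ℝ)
    (y ν : ℕ → Fin N → ℝ) (X : ℕ → Matrix (Fin N) (Fin r ⊕ Fin N ⊕ Fin N) ℝ)
    (hX : ∀ t, X t = Xdes (F (t - 1)) (y (t - 1)))
    (S : Matrix (Fin r ⊕ Fin N ⊕ Fin N) (Fin r ⊕ Fin N ⊕ Fin N) ℝ)
    (h : frobNorm (((T : ℝ)⁻¹ • ∑ t ∈ Finset.Icc 1 T,
              Matrix.vecMulVec ((X t)ᵀ.mulVec (ν t)) ((X t)ᵀ.mulVec (ν t))) - S) ≤ 1) :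
    (T : ℝ)⁻¹ * ∑ t ∈ Finset.Icc 1 T, ν t ⬝ᵥ ν t
      ≤ ∑ i : Fin N, (|S (Sum.inr (Sum.inr i)) (Sum.inr (Sum.inr i))| + 1) := by
  set M := ((T : ℝ)⁻¹ • ∑ t ∈ Finset.Icc 1 T,
              Matrix.vecMulVec ((X t)ᵀ.mulVec (ν t)) ((X t)ᵀ.mulVec (ν t))) with hM
  have hf : fsq (M - S) ≤ 1 := by
    rw [← frobNorm_sq]
    have : 0 ≤ frobNorm (M - S) := Real.sqrt_nonneg _
    nlinarith
  have hent : ∀ c, M c c ≤ |S c c| + 1 := by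
    intro c
    have h1 : ((M - S) c c) ^ 2 ≤ fsq (M - S) := by
      unfold fsq
      refine le_trans ?_ (Finset.single_le_sum (f := fun i => ∑ j, (M - S) i j ^ 2)
        (fun i _ => Finset.sum_nonneg fun j _ => sq_nonneg _) (Finset.mem_univ c))
      exact Finset.single_le_sum (f := fun j => (M - S) c j ^ 2)
        (fun j _ => sq_nonneg _) (Finset.mem_univ c)
    have h2 : (M c c - S c c) ^ 2 ≤ 1 := h1.trans hf
    have h3 : M c c - S c c ≤ 1 := by nlinarith
    linarith [le_abs_self (S c c)]
  have hMi : ∀ i : Fin N, M (Sum.inr (Sum.inr i)) (Sum.inr (Sum.inr i))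
      = (T : ℝ)⁻¹ * ∑ t ∈ Finset.Icc 1 T, ν t i * ν t i := by
    intro i
    rw [hM, Matrix.smul_apply, Matrix.sum_apply, smul_eq_mul]
    congr 1
    refine Finset.sum_congr rfl fun t _ => ?_
    rw [Matrix.vecMulVec_apply, hX, Xdes_nu]
  calc (T : ℝ)⁻¹ * ∑ t ∈ Finset.Icc 1 T, ν t ⬝ᵥ ν t
      = ∑ i : Fin N, (T : ℝ)⁻¹ * ∑ t ∈ Finset.Icc 1 T, ν t i * ν t i := by
        rw [← Finset.mul_sum, Finset.sum_comm]; rfl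
    _ ≤ _ := Finset.sum_le_sum fun i _ => by rw [← hMi]; exact hent _

lemma rho_small (η : ℝ) (hη : 0 < η) : ∃ n₀ : ℕ, 0 < n₀ ∧ ∀ m T : ℕ, n₀ ≤ m → n₀ ≤ T →
    max (T : ℝ)⁻¹ (m : ℝ)⁻¹ ≤ η := by
  obtain ⟨n, hn⟩ := exists_nat_gt η⁻¹
  have hη' : 0 < η⁻¹ := by positivity
  have hn0 : (0 : ℝ) < n := hη'.trans hn
  refine ⟨n, by exact_mod_cast hn0, fun m T hm hT => max_le ?_ ?_⟩
  · have : (n : ℝ) ≤ T := by exact_mod_cast hT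
    exact inv_le_of_inv_le₀ hη (hn.le.trans this)
  · have : (n : ℝ) ≤ m := by exact_mod_cast hm
    exact inv_le_of_inv_le₀ hη (hn.le.trans this)

lemma gap_const {r : ℕ} (clo cup : Fin r → ℝ) (hclo : ∀ j, 0 < clo j)
    (hsep : ∀ j k : Fin r, (j : ℕ) + 1 = (k : ℕ) → cup k < clo j) :
    ∃ γ : ℝ, 0 < γ ∧ (∀ j, γ ≤ clo j) ∧
      ∀ j k : Fin r, (j : ℕ) + 1 = (k : ℕ) → γ ≤ clo j - cup k := by
  have h1 : ∀ᶠ γ in nhdsWithin (0 : ℝ) (Set.Ioi 0), ∀ j, γ ≤ clo j :=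
    Filter.eventually_all.2 fun j => nhdsWithin_le_nhds (Iic_mem_nhds (hclo j))
  have h2 : ∀ᶠ γ in nhdsWithin (0 : ℝ) (Set.Ioi 0),
      ∀ j k : Fin r, (j : ℕ) + 1 = (k : ℕ) → γ ≤ clo j - cup k :=
    Filter.eventually_all.2 fun j => Filter.eventually_all.2 fun k => by
      by_cases h : (j : ℕ) + 1 = (k : ℕ)
      · filter_upwards [nhdsWithin_le_nhds (Iic_mem_nhds (sub_pos.2 (hsep j k h)))] with γ hγ _
        exact hγ
      · exact Filter.Eventually.of_forall fun γ h' => absurd h' h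
  obtain ⟨γ, hγ⟩ := (h1.and (h2.and self_mem_nhdsWithin)).exists
  exact ⟨γ, hγ.2.2, hγ.1, hγ.2.1⟩

lemma gap_of {r : ℕ} (clo cup : Fin r → ℝ) (γ : ℝ)
    (hγ2 : ∀ j k : Fin r, (j : ℕ) + 1 = (k : ℕ) → γ ≤ clo j - cup k)
    (μ : Fin r → ℝ) (hdec : ∀ j k : Fin r, j < k → μ k < μ j) (m : ℝ) (hm : 0 ≤ m)
    (hp : ∀ j, clo j * m < μ j ∧ μ j < cup j * m) :
    ∀ i j, i ≠ j → γ * m ≤ |μ i - μ j| := by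
  have hlt : ∀ i j : Fin r, i < j → γ * m ≤ μ i - μ j := by
    intro i j hij
    have hij' : (i : ℕ) < j := hij
    let k : Fin r := ⟨i + 1, by omega⟩
    have hk : μ j ≤ μ k := by
      rcases (show k ≤ j from (by change (i : ℕ) + 1 ≤ j; omega)).eq_or_lt with h | h
      · rw [h]
      · exact (hdec k j h).le
    have h1 := mul_le_mul_of_nonneg_right (hγ2 i k rfl) hm
    have h2 := (hp i).1
    have h3 := (hp k).2
    linarith
  intro i j hij
  rcases lt_or_gt_of_ne hij with h | h
  · exact (hlt i j h).trans (le_abs_self _)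
  · rw [abs_sub_comm]; exact (hlt j i h).trans (le_abs_self _)

end Rate

section Final

lemma det_bound {N r T : ℕ} (hT : 0 < T) (X Xh : ℕ → Matrix (Fin N) (Fin r ⊕ Fin N ⊕ Fin N) ℝ)
    (s : Fin r → ℝ) (hs : ∀ j, s j * s j = 1) (β : Fin r → ℝ) (ρ' αc : Fin N → ℝ)
    (θh : (Fin r ⊕ Fin N ⊕ Fin N) → ℝ) (y ν : ℕ → Fin N → ℝ)
    (hy : ∀ t, 1 ≤ t → t ≤ T → y t = X t *ᵥ (Sum.elim β (Sum.elim ρ' αc)) + ν t)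
    (hS : IsUnit ((T : ℝ)⁻¹ • ∑ t ∈ Finset.Icc 1 T, (Xh t)ᵀ * Xh t))
    (hθh : θh = (∑ t ∈ Finset.Icc 1 T, (Xh t)ᵀ * Xh t)⁻¹ *ᵥ
      (∑ t ∈ Finset.Icc 1 T, (Xh t)ᵀ *ᵥ y t))
    (C1 L3 C4 nb C5 ρ δ : ℝ) (hL3 : 0 ≤ L3) (hC4 : 0 ≤ C4) (hnb : 0 ≤ nb) (hC5 : 0 ≤ C5)
    (hρ0 : 0 ≤ ρ) (hρ1 : ρ ≤ 1) (hTρ : (T : ℝ)⁻¹ ≤ ρ) (hδ : 0 ≤ δ)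
    (hSi : frobNorm (((T : ℝ)⁻¹ • ∑ t ∈ Finset.Icc 1 T, (Xh t)ᵀ * Xh t)⁻¹) ≤ C1)
    (hD : (T : ℝ)⁻¹ * ∑ t ∈ Finset.Icc 1 T,
      fsq (Xh t - X t * Matrix.diagonal (Sum.elim s (fun _ => 1))) ≤ L3 * ρ)
    (hX : (T : ℝ)⁻¹ * ∑ t ∈ Finset.Icc 1 T, fsq (X t) ≤ C4)
    (hn : (T : ℝ)⁻¹ * ∑ t ∈ Finset.Icc 1 T, ν t ⬝ᵥ ν t ≤ nb)
    (hz : ((Real.sqrt T)⁻¹ • ∑ t ∈ Finset.Icc 1 T, (X t)ᵀ *ᵥ ν t) ⬝ᵥ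
      ((Real.sqrt T)⁻¹ • ∑ t ∈ Finset.Icc 1 T, (X t)ᵀ *ᵥ ν t) ≤ C5)
    (hfin : (C1 ^ 2 * (3 * (C5 + L3 * nb + (2 * L3 + 2 * C4) *
      (L3 * ((Sum.elim β (Sum.elim ρ' αc)) ⬝ᵥ (Sum.elim β (Sum.elim ρ' αc)))))) + 1) * ρ ≤ δ ^ 2) :
    Real.sqrt (∑ c, (θh c -
      Sum.elim (fun k => (β ᵥ* Matrix.diagonal s) k) (Sum.elim ρ' αc) c) ^ 2) ≤ δ := by
  have hT' : (0 : ℝ) < T := by exact_mod_cast hT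
  set θ : (Fin r ⊕ Fin N ⊕ Fin N) → ℝ := Sum.elim β (Sum.elim ρ' αc) with hθ
  set θs : (Fin r ⊕ Fin N ⊕ Fin N) → ℝ :=
    Sum.elim (fun k => (β ᵥ* Matrix.diagonal s) k) (Sum.elim ρ' αc) with hθs
  have hθ0 : 0 ≤ θ ⬝ᵥ θ := dot_self_nonneg _
  set z := ∑ t ∈ Finset.Icc 1 T, (X t)ᵀ *ᵥ ν t with hzdef
  have hz' : ((T : ℝ)⁻¹ • z) ⬝ᵥ ((T : ℝ)⁻¹ • z) ≤ C5 * ρ := by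
    have e1 : ((T : ℝ)⁻¹ • z) ⬝ᵥ ((T : ℝ)⁻¹ • z)
        = (T : ℝ)⁻¹ * (((Real.sqrt T)⁻¹ • z) ⬝ᵥ ((Real.sqrt T)⁻¹ • z)) := by
      simp only [smul_dotProduct, dotProduct_smul, smul_eq_mul]
      have : (Real.sqrt T)⁻¹ * ((Real.sqrt T)⁻¹ * (z ⬝ᵥ z)) = (T : ℝ)⁻¹ * (z ⬝ᵥ z) := by
        rw [← mul_assoc, ← mul_inv, Real.mul_self_sqrt hT'.le]
      rw [this]
    rw [e1]
    have := mul_le_mul hTρ hz (dot_self_nonneg _) hρ0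
    linarith
  have hb := ols_bound T hT X Xh (Sum.elim s (fun _ => 1)) (by
      rintro (c | c)
      · exact hs c
      · simp) θ θs θh (by
      rintro (c | c)
      · simp only [hθs, hθ, Sum.elim_inl, Matrix.vecMul_diagonal]; ring
      · simp [hθs, hθ]) y ν hy hS hθh (L3 * ρ) C4 nb (C5 * ρ) hD hX hn hz'
  have hsq : fsq (((T : ℝ)⁻¹ • ∑ t ∈ Finset.Icc 1 T, (Xh t)ᵀ * Xh t)⁻¹) ≤ C1 ^ 2 := by
    rw [← frobNorm_sq]
    exact pow_le_pow_left₀ (Real.sqrt_nonneg _) hSi 2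
  have hin : 3 * (C5 * ρ + L3 * ρ * nb + (2 * (L3 * ρ) + 2 * C4) * (L3 * ρ * (θ ⬝ᵥ θ)))
      ≤ 3 * (C5 + L3 * nb + (2 * L3 + 2 * C4) * (L3 * (θ ⬝ᵥ θ))) * ρ := by
    have q1 : 0 ≤ L3 * (L3 * ρ * (θ ⬝ᵥ θ)) := by positivity
    have q2 := mul_le_mul_of_nonneg_left hρ1 q1
    nlinarith
  have hin0 : 0 ≤ 3 * (C5 * ρ + L3 * ρ * nb + (2 * (L3 * ρ) + 2 * C4) * (L3 * ρ * (θ ⬝ᵥ θ))) := by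
    positivity
  have h1 : (θh - θs) ⬝ᵥ (θh - θs) ≤ δ ^ 2 := by
    refine hb.trans ((mul_le_mul hsq hin hin0 (sq_nonneg _)).trans ?_)
    nlinarith
  rw [Real.sqrt_le_iff]
  refine ⟨hδ, le_trans (le_of_eq ?_) h1⟩
  simp only [dotProduct, Pi.sub_apply]
  exact Finset.sum_congr rfl fun c _ => by ring

lemma union5 {Ω : Type} [MeasurableSpace Ω] (P : Measure Ω) (B A1 A2 A3 A4 A5 : Set Ω) (ε : ℝ)
    (hε : 0 < ε) (hsub : ∀ ω, ω ∉ A1 → ω ∉ A2 → ω ∉ A3 → ω ∉ A4 → ω ∉ A5 → ω ∉ B)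
    (h1 : P A1 ≤ ENNReal.ofReal (ε / 6)) (h2 : P A2 ≤ ENNReal.ofReal (ε / 6))
    (h3 : P A3 ≤ ENNReal.ofReal (ε / 6)) (h4 : P A4 ≤ ENNReal.ofReal (ε / 6))
    (h5 : P A5 ≤ ENNReal.ofReal (ε / 6)) : P B < ENNReal.ofReal ε := by
  have hB : B ⊆ A1 ∪ (A2 ∪ (A3 ∪ (A4 ∪ A5))) := by
    intro ω hω
    by_contra hc
    simp only [Set.mem_union, not_or] at hc
    exact hsub ω hc.1 hc.2.1 hc.2.2.1 hc.2.2.2.1 hc.2.2.2.2 hω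
  have hp : 0 ≤ ε / 6 := by positivity
  calc P B ≤ P (A1 ∪ (A2 ∪ (A3 ∪ (A4 ∪ A5)))) := measure_mono hB
    _ ≤ P A1 + (P A2 + (P A3 + (P A4 + P A5))) := by
        refine (measure_union_le _ _).trans (add_le_add le_rfl ?_)
        refine (measure_union_le _ _).trans (add_le_add le_rfl ?_)
        refine (measure_union_le _ _).trans (add_le_add le_rfl ?_)
        exact measure_union_le _ _
    _ ≤ ENNReal.ofReal (ε / 6) + (ENNReal.ofReal (ε / 6) + (ENNReal.ofReal (ε / 6)
        + (ENNReal.ofReal (ε / 6) + ENNReal.ofReal (ε / 6)))) := by gcongr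
    _ = ENNReal.ofReal (ε / 6 + (ε / 6 + (ε / 6 + (ε / 6 + ε / 6)))) := by
        rw [ENNReal.ofReal_add hp (by positivity), ENNReal.ofReal_add hp (by positivity),
          ENNReal.ofReal_add hp (by positivity), ENNReal.ofReal_add hp hp]
    _ < ENNReal.ofReal ε := (ENNReal.ofReal_lt_ofReal_iff hε).2 (by linarith)

lemma frob_event {Ω : Type} {a b : Type} [Fintype a] [Fintype b] (m T : ℕ) (L : ℝ) (hL : 0 ≤ L)
    (G : Ω → Matrix a b ℝ) :
    {ω | Real.sqrt L * max (Real.sqrt T)⁻¹ (Real.sqrt m)⁻¹ < frobNorm (G ω)}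
      ⊆ {ω | L * max (T : ℝ)⁻¹ (m : ℝ)⁻¹ < fsq (G ω)} := by
  intro ω hω
  have hω' : Real.sqrt L * max (Real.sqrt T)⁻¹ (Real.sqrt m)⁻¹ < frobNorm (G ω) := hω
  change L * max (T : ℝ)⁻¹ (m : ℝ)⁻¹ < fsq (G ω)
  set M := max (Real.sqrt T)⁻¹ (Real.sqrt m)⁻¹ with hM
  have hM1 : (Real.sqrt T)⁻¹ ≤ M := le_max_left _ _
  have hM2 : (Real.sqrt m)⁻¹ ≤ M := le_max_right _ _
  have hM0 : 0 ≤ M := le_trans (by positivity) hM1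
  have hle : max (T : ℝ)⁻¹ (m : ℝ)⁻¹ ≤ M ^ 2 := by
    refine max_le ?_ ?_
    · have := pow_le_pow_left₀ (by positivity) hM1 2
      rwa [inv_pow, Real.sq_sqrt (Nat.cast_nonneg T)] at this
    · have := pow_le_pow_left₀ (by positivity) hM2 2
      rwa [inv_pow, Real.sq_sqrt (Nat.cast_nonneg m)] at this
  have h1 : (Real.sqrt L * M) ^ 2 < frobNorm (G ω) ^ 2 :=
    pow_lt_pow_left₀ hω' (by positivity) two_ne_zero
  rw [frobNorm_sq, mul_pow, Real.sq_sqrt hL] at h1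
  exact (mul_le_mul_of_nonneg_left hle hL).trans_lt h1

end Final

set_option maxHeartbeats 4000000 in
/-- **Proposition 2.** Consistency of the feasible least-squares estimator of the
factor network autoregressive (FNAR) model using estimated factors, under
Assumptions 1–9, as `m, T → ∞`. -/
theorem proposition2
    (N r : ℕ) (hr : 0 < r) (hN : 0 < N)
    -- a probability space for each pair (m, T)
    (Ω : ℕ → ℕ → Type) (instΩ : ∀ m T, MeasurableSpace (Ω m T))
    (P : ∀ m T, Measure (Ω m T)) (hP : ∀ m T, IsProbabilityMeasure (P m T))
    -- common and idiosyncratic components of the matricized weight tensor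
    (χ Err W : ∀ m T : ℕ, ℕ → Ω m T → Matrix (Fin m) (Fin N × Fin N) ℝ)
    (hW : ∀ m T t ω, W m T t ω = χ m T t ω + Err m T t ω)
    -- Assumption 1: spectral data of Γ^χ = E[χ_t·χ_tᵀ], factors and loadings
    (V : ∀ m T : ℕ, Matrix (Fin m) (Fin r) ℝ) (μ : ℕ → ℕ → Fin r → ℝ)
    (hVorth : ∀ m T, r ≤ m → (V m T)ᵀ * V m T = 1)
    (hμpos : ∀ m T j, 0 < μ m T j)
    (hμdec : ∀ m T, ∀ j k : Fin r, j < k → μ m T k < μ m T j)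
    (hΓχ : ∀ m T t, t ≤ T → ∀ i j,
      Integrable (fun ω => (χ m T t ω * (χ m T t ω)ᵀ) i j) (P m T) ∧
      ∫ ω, (χ m T t ω * (χ m T t ω)ᵀ) i j ∂(P m T)
        = (V m T * Matrix.diagonal (μ m T) * (V m T)ᵀ) i j)
    (F : ∀ m T : ℕ, ℕ → Ω m T → Matrix (Fin r) (Fin N × Fin N) ℝ)
    (hF : ∀ m T t ω, F m T t ω
      = Matrix.diagonal (fun j => (Real.sqrt (μ m T j))⁻¹) * (V m T)ᵀ * χ m T t ω)
    (U : ∀ m T : ℕ, Matrix (Fin m) (Fin r) ℝ)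
    (hU : ∀ m T, U m T = V m T * Matrix.diagonal (fun j => Real.sqrt (μ m T j)))
    -- Assumption 2: idiosyncratic moments
    (hEmean : ∀ m T t, t ≤ T → ∀ i j,
      Integrable (fun ω => Err m T t ω i j) (P m T) ∧
      ∫ ω, Err m T t ω i j ∂(P m T) = 0)
    (hE4 : ∀ m T t, t ≤ T →
      Integrable (fun ω => (frobNorm (Err m T t ω)) ^ 4) (P m T))
    -- Assumption 3: errors and factors uncorrelated
    (hEF : ∀ m T t, t ≤ T → ∀ i j,
      Integrable (fun ω => (Err m T t ω * (F m T t ω)ᵀ) i j) (P m T) ∧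
      ∫ ω, (Err m T t ω * (F m T t ω)ᵀ) i j ∂(P m T) = 0)
    -- Assumption 4: pervasiveness of the common factors
    (clo cup : Fin r → ℝ)
    (hclo : ∀ j, 0 < clo j)
    (hsep : ∀ j k : Fin r, (j : ℕ) + 1 = (k : ℕ) → cup k < clo j)
    (hperv : ∃ m₀, ∀ m, m₀ ≤ m → ∀ T, ∀ j,
      clo j * m < μ m T j ∧ μ m T j < cup j * m)
    -- Assumption 5: non-pervasiveness of the idiosyncratic components
    (ΓE : ∀ m T : ℕ, Matrix (Fin m) (Fin m) ℝ) (lam : ℝ)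
    (hΓE : ∀ m T t, t ≤ T → ∀ i j,
      Integrable (fun ω => (Err m T t ω * (Err m T t ω)ᵀ) i j) (P m T) ∧
      ∫ ω, (Err m T t ω * (Err m T t ω)ᵀ) i j ∂(P m T) = ΓE m T i j)
    (hlam : ∀ m T, ∀ x : Fin m → ℝ, x ⬝ᵥ (ΓE m T).mulVec x ≤ lam * (x ⬝ᵥ x))
    -- sample covariance Γ̂ = (1/T)·Σ_t W_(3)t·W_(3)tᵀ and population Γ^W
    (Γhat : ∀ m T : ℕ, Ω m T → Matrix (Fin m) (Fin m) ℝ)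
    (hΓhat : ∀ m T ω, Γhat m T ω
      = (T : ℝ)⁻¹ • ∑ t ∈ Finset.Icc 1 T, W m T t ω * (W m T t ω)ᵀ)
    (ΓW : ∀ m T : ℕ, Matrix (Fin m) (Fin m) ℝ)
    (hΓW : ∀ m T t, t ≤ T → ∀ i j,
      Integrable (fun ω => (W m T t ω * (W m T t ω)ᵀ) i j) (P m T) ∧
      ∫ ω, (W m T t ω * (W m T t ω)ᵀ) i j ∂(P m T) = ΓW m T i j)
    -- Assumption 6: convergence of the sample covariance
    (R : ℝ)
    (hA6 : ∀ m T, 1 ≤ T → ∀ i j,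
      Integrable (fun ω => (Γhat m T ω i j - ΓW m T i j) ^ 2) (P m T) ∧
      (T : ℝ) * ∫ ω, (Γhat m T ω i j - ΓW m T i j) ^ 2 ∂(P m T) ≤ R)
    -- estimated eigenvalues/eigenvectors of Γ̂ and estimated factors
    (μhat : ∀ m T : ℕ, Ω m T → Fin r → ℝ)
    (Vhat : ∀ m T : ℕ, Ω m T → Matrix (Fin m) (Fin r) ℝ)
    (hVhatOrth : ∀ m T ω, r ≤ m → (Vhat m T ω)ᵀ * Vhat m T ω = 1)
    (hEigen : ∀ m T ω, Γhat m T ω * Vhat m T ω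
      = Vhat m T ω * Matrix.diagonal (μhat m T ω))
    (hμhatDec : ∀ m T ω, Antitone (μhat m T ω))
    (hTop : ∀ m T ω (ν' : ℝ) (x : Fin m → ℝ), x ≠ 0 →
      (Γhat m T ω).mulVec x = ν' • x → (Vhat m T ω)ᵀ.mulVec x = 0 →
      ∀ j, ν' ≤ μhat m T ω j)
    (Fhat : ∀ m T : ℕ, ℕ → Ω m T → Matrix (Fin r) (Fin N × Fin N) ℝ)
    (hFhat : ∀ m T t ω, Fhat m T t ω
      = Matrix.diagonal (fun j => (Real.sqrt (μhat m T ω j))⁻¹) * (Vhat m T ω)ᵀ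
          * W m T t ω)
    -- the FNAR model: y_t = X_t·θ + ν_t, θ = (β₁,…,β_r, ρ₁,…,ρ_N, α₁,…,α_N)
    (y ν : ∀ m T : ℕ, ℕ → Ω m T → (Fin N → ℝ))
    (β : Fin r → ℝ) (ρ αc : Fin N → ℝ)
    (Xmat Xhat : ∀ m T : ℕ, ℕ → Ω m T → Matrix (Fin N) (Fin r ⊕ Fin N ⊕ Fin N) ℝ)
    (hXmat : ∀ m T t ω, Xmat m T t ω = Matrix.of fun i c =>
      Sum.elim (fun k => ∑ j, F m T (t - 1) ω k (i, j) * y m T (t - 1) ω j)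
        (Sum.elim (fun i' => if i = i' then y m T (t - 1) ω i else 0)
          (fun i' => if i = i' then (1 : ℝ) else 0)) c)
    (hXhat : ∀ m T t ω, Xhat m T t ω = Matrix.of fun i c =>
      Sum.elim (fun k => ∑ j, Fhat m T (t - 1) ω k (i, j) * y m T (t - 1) ω j)
        (Sum.elim (fun i' => if i = i' then y m T (t - 1) ω i else 0)
          (fun i' => if i = i' then (1 : ℝ) else 0)) c)
    (hModel : ∀ m T t, 1 ≤ t → t ≤ T → ∀ ω,
      y m T t ω = (Xmat m T t ω).mulVec (Sum.elim β (Sum.elim ρ αc)) + ν m T t ω)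
    -- Assumption 7: E‖X_t‖_F⁸ ≤ M < ∞
    (Mbd : ℝ)
    (hA7 : ∀ m T t, 1 ≤ t → t ≤ T →
      Integrable (fun ω => (frobNorm (Xmat m T t ω)) ^ 8) (P m T) ∧
      ∫ ω, (frobNorm (Xmat m T t ω)) ^ 8 ∂(P m T) ≤ Mbd)
    -- Assumption 8: T^{-1/2}·Σ_t X_tᵀν_t →d N(0, Σ_{Xν}),
    -- Σ_{Xν} = plim T^{-1}·Σ_t X_tᵀν_tν_tᵀX_t
    (SigXv : Matrix (Fin r ⊕ Fin N ⊕ Fin N) (Fin r ⊕ Fin N ⊕ Fin N) ℝ)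
    (hplim : ∀ ε : ℝ, 0 < ε → ∀ δ : ℝ, 0 < δ → ∃ m₀ T₀ : ℕ, ∀ m T : ℕ,
      m₀ ≤ m → T₀ ≤ T →
      P m T {ω | δ < frobNorm
          (((T : ℝ)⁻¹ • ∑ t ∈ Finset.Icc 1 T,
              Matrix.vecMulVec ((Xmat m T t ω)ᵀ.mulVec (ν m T t ω))
                ((Xmat m T t ω)ᵀ.mulVec (ν m T t ω))) - SigXv)}
        < ENNReal.ofReal ε)
    (hCLT : ∃ L : Measure ((Fin r ⊕ Fin N ⊕ Fin N) → ℝ),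
      IsProbabilityMeasure L ∧
      (∀ l : (Fin r ⊕ Fin N ⊕ Fin N) → ℝ,
        L.map (fun x => ∑ c, l c * x c)
          = gaussianReal 0 (Real.toNNReal (l ⬝ᵥ SigXv.mulVec l))) ∧
      (∀ f : BoundedContinuousFunction ((Fin r ⊕ Fin N ⊕ Fin N) → ℝ) ℝ,
        ∀ ε : ℝ, 0 < ε → ∃ m₀ T₀ : ℕ, ∀ m T : ℕ, m₀ ≤ m → T₀ ≤ T →
        |(∫ ω, f ((Real.sqrt T)⁻¹ • ∑ t ∈ Finset.Icc 1 T,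
              (Xmat m T t ω)ᵀ.mulVec (ν m T t ω)) ∂(P m T)) - ∫ x, f x ∂L| < ε))
    -- Assumption 9: E[ν_t | X_t] = 0 and (X_t, ν_t) independent of E_s for all s
    (hCondExp : ∀ m T t, 1 ≤ t → t ≤ T → ∀ i,
      (P m T)[(fun ω => ν m T t ω i) |
          MeasurableSpace.comap (fun ω => (fun i' c => Xmat m T t ω i' c :
            Fin N → (Fin r ⊕ Fin N ⊕ Fin N) → ℝ)) inferInstance]
        =ᵐ[P m T] fun _ => 0)
    (hIndep : ∀ m T t s, 1 ≤ t → t ≤ T → s ≤ T →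
      IndepFun
        (fun ω => ((fun i c => Xmat m T t ω i c : Fin N → (Fin r ⊕ Fin N ⊕ Fin N) → ℝ),
          (fun i => ν m T t ω i : Fin N → ℝ)))
        (fun ω => (fun i j => Err m T s ω i j : Fin m → (Fin N × Fin N) → ℝ))
        (P m T))
    -- additional assumption: (T⁻¹·Σ_t X̂_tᵀX̂_t)⁻¹ exists w.p.a. 1 and is O_p(1)
    (hSinv : ∀ ε : ℝ, 0 < ε → ∃ C : ℝ, 0 < C ∧ ∃ m₀ T₀ : ℕ, ∀ m T : ℕ,
      m₀ ≤ m → T₀ ≤ T →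
      P m T {ω | ¬ (IsUnit ((T : ℝ)⁻¹ • ∑ t ∈ Finset.Icc 1 T,
            (Xhat m T t ω)ᵀ * Xhat m T t ω) ∧
          frobNorm (((T : ℝ)⁻¹ • ∑ t ∈ Finset.Icc 1 T,
            (Xhat m T t ω)ᵀ * Xhat m T t ω)⁻¹) ≤ C)}
        < ENNReal.ofReal ε)
    -- the feasible least-squares estimator θ̂
    (θhat : ∀ m T : ℕ, Ω m T → (Fin r ⊕ Fin N ⊕ Fin N) → ℝ)
    (hθhat : ∀ m T ω, θhat m T ω
      = (∑ t ∈ Finset.Icc 1 T, (Xhat m T t ω)ᵀ * Xhat m T t ω)⁻¹.mulVec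
          (∑ t ∈ Finset.Icc 1 T, (Xhat m T t ω)ᵀ.mulVec (y m T t ω))) :
    -- conclusion: θ̂ − θ* → 0 in probability, where
    -- θ* = (βᵀ·Ĵ_r, ρ₁,…,ρ_N, α₁,…,α_N)ᵀ and Ĵ_r is the sign matrix of Prop. 1
    ∃ J : ∀ m T : ℕ, Ω m T → Matrix (Fin r) (Fin r) ℝ,
      (∀ m T ω, (J m T ω).IsDiag ∧ ∀ j, J m T ω j j = 1 ∨ J m T ω j j = -1) ∧
      (∀ ε : ℝ, 0 < ε → ∃ C : ℝ, 0 < C ∧ ∃ m₀ T₀ : ℕ, ∀ m T : ℕ,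
        m₀ ≤ m → T₀ ≤ T → ∀ t, t ≤ T →
        P m T {ω | C * max (Real.sqrt T)⁻¹ (Real.sqrt m)⁻¹
            < frobNorm (Fhat m T t ω - J m T ω * F m T t ω)}
          < ENNReal.ofReal ε) ∧
      (∀ ε : ℝ, 0 < ε → ∀ δ : ℝ, 0 < δ → ∃ m₀ T₀ : ℕ, ∀ m T : ℕ,
        m₀ ≤ m → T₀ ≤ T →
        P m T {ω | δ < Real.sqrt (∑ c, (θhat m T ω c -
            Sum.elim (fun k => (β ᵥ* J m T ω) k) (Sum.elim ρ αc) c) ^ 2)}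
          < ENNReal.ofReal ε) := by
  obtain ⟨m1, hm1⟩ := hperv
  obtain ⟨γ, hγ, hγ1, hγ2⟩ := gap_const clo cup hclo hsep
  set κ : ℝ := (∑ j, |cup j|) / γ with hκdef
  have hκ : 0 ≤ κ := div_nonneg (Finset.sum_nonneg fun j _ => abs_nonneg _) hγ.le
  set K : ℝ := Kc r κ with hKdef
  have hK : 0 ≤ K := by rw [hKdef]; unfold Kc; positivity
  set lam' : ℝ := max lam 0 with hlam'def
  have hlam0 : 0 ≤ lam' := le_max_right _ _
  have hlam' : ∀ m T, ∀ x : Fin m → ℝ, x ⬝ᵥ (ΓE m T).mulVec x ≤ lam' * (x ⬝ᵥ x) :=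
    fun m T x => (hlam m T x).trans
      (mul_le_mul_of_nonneg_right (le_max_left _ _) (dot_self_nonneg _))
  set A0 : ℝ := (2 * |R| + 2 * lam' ^ 2) / γ ^ 2 with hA0def
  have hA0 : 0 ≤ A0 := by positivity
  set MB : ℝ := |Mbd| + 1 with hMBdef
  have hMB : 0 < MB := by positivity
  have hcore : ∀ m T, m1 ≤ m → r ≤ m → 0 < T → ∃ a : Ω m T → ℝ, Integrable a (P m T) ∧
      (∀ ω, 0 ≤ a ω) ∧ ∫ ω, a ω ∂(P m T) ≤ A0 * max (T : ℝ)⁻¹ (m : ℝ)⁻¹ ∧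
      ∀ᵐ ω ∂(P m T), a ω ≤ 1 / 4 → ∀ t, t ≤ T → ∀ (n : Type) [Fintype n]
        (Y : Matrix (Fin N × Fin N) n ℝ),
        fsq ((Fhat m T t ω - Matrix.diagonal (sgnv ((V m T)ᵀ * Vhat m T ω)) * F m T t ω) * Y)
          ≤ a ω * (2 * K * fsq (F m T t ω * Y) + 8 / (γ * m) * K * fsq (Err m T t ω * Y))
            + 8 / (γ * m) * fsq ((V m T)ᵀ * Err m T t ω * Y) := by
    intro m T hmm hrm hT
    have hm0 : 0 < m := lt_of_lt_of_le hr hrm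
    have hm' : (0 : ℝ) < m := by exact_mod_cast hm0
    refine core hm0 hT (χ m T) (Err m T) (W m T) (hW m T) (V m T) (hVorth m T hrm) (μ m T)
      (hμpos m T) ?_ (hΓχ m T) (F m T) (hF m T) (hEF m T) γ κ hγ hκ
      (gap_of clo cup γ hγ2 (μ m T) (hμdec m T) m hm'.le (hm1 m hmm T)) ?_ ?_
      (ΓE m T) lam' (hΓE m T) (hlam' m T) (Γhat m T) (hΓhat m T) (ΓW m T) (hΓW m T) R
      (hA6 m T hT) (μhat m T) (Vhat m T) (fun ω => hVhatOrth m T ω hrm) (hEigen m T)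
      (hμhatDec m T) (hTop m T) (Fhat m T) (hFhat m T)
    · intro i j hij
      rcases hij.eq_or_lt with h | h
      · rw [h]
      · exact (hμdec m T i j h).le
    · intro j
      exact (mul_le_mul_of_nonneg_right (hγ1 j) hm'.le).trans (hm1 m hmm T j).1.le
    · intro j
      have h1 := (hm1 m hmm T j).2.le
      have h2 : cup j ≤ ∑ j, |cup j| :=
        (le_abs_self _).trans (Finset.single_le_sum (f := fun j => |cup j|)
          (fun i _ => abs_nonneg _) (Finset.mem_univ j))
      have h3 : κ * (γ * m) = (∑ j, |cup j|) * m := by rw [hκdef]; field_simp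
      rw [h3]
      exact h1.trans (mul_le_mul_of_nonneg_right h2 hm'.le)
  have hEm : ∀ m T, r ≤ m → ∀ t, t ≤ T →
      (Integrable (fun ω => fsq (Err m T t ω)) (P m T) ∧
        ∫ ω, fsq (Err m T t ω) ∂(P m T) ≤ lam' * m) ∧
      (Integrable (fun ω => fsq ((V m T)ᵀ * Err m T t ω)) (P m T) ∧
        ∫ ω, fsq ((V m T)ᵀ * Err m T t ω) ∂(P m T) ≤ lam' * r) := fun m T hrm t ht =>
    err_moments (Err m T t) (ΓE m T) lam' (hΓE m T t ht) (hlam' m T) (V m T) (hVorth m T hrm)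
  have hXm : ∀ m T t, 1 ≤ t → t ≤ T → Integrable (fun ω => fsq (Xmat m T t ω)) (P m T) ∧
      ∫ ω, fsq (Xmat m T t ω) ∂(P m T) ≤ MB := fun m T t h1 h2 =>
    X_moment (Xmat m T t) |Mbd| (hA7 m T t h1 h2).1 ((hA7 m T t h1 h2).2.trans (le_abs_self _))
  have hr0 : (0 : ℝ) ≤ r := Nat.cast_nonneg r
  refine ⟨fun m T ω => Matrix.diagonal (sgnv ((V m T)ᵀ * Vhat m T ω)), ?_, ?_, ?_⟩
  · intro m T ω
    refine ⟨Matrix.isDiag_diagonal _, fun j => ?_⟩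
    have hj : Matrix.diagonal (sgnv ((V m T)ᵀ * Vhat m T ω)) j j
        = sgnv ((V m T)ᵀ * Vhat m T ω) j := Matrix.diagonal_apply_eq _ _
    change Matrix.diagonal (sgnv ((V m T)ᵀ * Vhat m T ω)) j j = 1
      ∨ Matrix.diagonal (sgnv ((V m T)ᵀ * Vhat m T ω)) j j = -1
    rw [hj]
    exact sgnv_cases _ j
  · intro ε hε
    set C2 : ℝ := A0 + 2 * K * r + 8 * K * lam' / γ + 8 * (lam' * r) / γ + 1 with hC2def
    have hC2 : 0 < C2 := by positivity
    have hL : 0 < (4 * C2 / ε) ^ 2 + 4 * C2 / ε := by positivity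
    obtain ⟨n₀, hn₀, hsm⟩ := rho_small (ε / (32 * C2)) (by positivity)
    refine ⟨Real.sqrt ((4 * C2 / ε) ^ 2 + 4 * C2 / ε), Real.sqrt_pos.2 hL,
      max m1 (max r n₀), n₀, ?_⟩
    intro m T hm hT t ht
    have hmm : m1 ≤ m := (le_max_left _ _).trans hm
    have hrm : r ≤ m := (le_max_left _ _).trans ((le_max_right _ _).trans hm)
    have hnm : n₀ ≤ m := (le_max_right _ _).trans ((le_max_right _ _).trans hm)
    have hm0 : 0 < m := lt_of_lt_of_le hr hrm
    have hT0 : 0 < T := lt_of_lt_of_le hn₀ hT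
    obtain ⟨a, ha, ha0, ha1, hbd⟩ := hcore m T hmm hrm hT0
    have hρ0 : 0 < max (T : ℝ)⁻¹ (m : ℝ)⁻¹ := lt_max_of_lt_right (by positivity)
    have hρε : 32 * C2 * max (T : ℝ)⁻¹ (m : ℝ)⁻¹ ≤ ε := by
      have := hsm m T hnm hT
      rw [le_div_iff₀ (by positivity)] at this
      linarith
    have hfm := fac_moment (χ m T t) (F m T t) (V m T) (hVorth m T hrm) (μ m T) (hμpos m T)
      (hF m T t) (hΓχ m T t ht)
    have hem := hEm m T hrm t ht
    refine lt_of_le_of_lt (measure_mono (frob_event m T _ hL.le _)) ?_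
    refine rate_scalar hm0 a (fun ω => fsq (F m T t ω)) (fun ω => fsq (Err m T t ω))
      (fun ω => fsq ((V m T)ᵀ * Err m T t ω)) _ A0 K γ r lam' (lam' * r) _ ε hA0 hK hγ hr0 hlam0
      (by positivity) hρ0 (le_max_right _ _) hε ha ha0 ha1 hfm.1 (fun ω => fsq_nonneg _) hfm.2.le
      hem.1.1 (fun ω => fsq_nonneg _) hem.1.2 hem.2.1 (fun ω => fsq_nonneg _) hem.2.2 ?_ hρε
    filter_upwards [hbd] with ω hω haω
    have h := hω haω t ht (Fin N × Fin N) 1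
    simpa only [Matrix.mul_one] using h
  · intro ε hε δ hδ
    have hε6 : 0 < ε / 6 := by positivity
    obtain ⟨C1, hC1, mS, TS, hS⟩ := hSinv (ε / 6) hε6
    obtain ⟨mp, Tp, hp⟩ := hplim (ε / 6) hε6 1 one_pos
    obtain ⟨L, hLp, -, hLc⟩ := hCLT
    set e6 : ℝ := min (ε / 12) (1 / 2) with he6
    have he60 : 0 < e6 := lt_min (by positivity) (by norm_num)
    have he61 : e6 < 1 := (min_le_right _ _).trans_lt (by norm_num)
    have he62 : 2 * e6 ≤ ε / 6 := by
      have := min_le_left (ε / 12) (1 / 2 : ℝ)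
      linarith
    obtain ⟨C5, hC5, f, hf0, hf1, hf2⟩ := tight_fun L e6 he60
    obtain ⟨mc, Tc, hc⟩ := hLc (BoundedContinuousFunction.const _ (1 : ℝ) + f) e6 he60
    set C3 : ℝ := A0 + 2 * K * MB + 8 * K * (lam' * MB) / γ + 8 * (lam' * r * MB) / γ + 1
      with hC3def
    have hC3 : 0 < C3 := by positivity
    set L3 : ℝ := (4 * C3 / (ε / 6)) ^ 2 + 4 * C3 / (ε / 6) with hL3def
    have hL3 : 0 ≤ L3 := by positivity
    set C4 : ℝ := MB / (ε / 6) with hC4def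
    have hC4 : 0 < C4 := by positivity
    set nb : ℝ := ∑ i : Fin N, (|SigXv (Sum.inr (Sum.inr i)) (Sum.inr (Sum.inr i))| + 1) with hnbdef
    have hnb : 0 ≤ nb := Finset.sum_nonneg fun i _ => by positivity
    set θ : (Fin r ⊕ Fin N ⊕ Fin N) → ℝ := Sum.elim β (Sum.elim ρ αc) with hθ
    have hθ0 : 0 ≤ θ ⬝ᵥ θ := dot_self_nonneg _
    set B : ℝ := C1 ^ 2 * (3 * (C5 + L3 * nb + (2 * L3 + 2 * C4) * (L3 * (θ ⬝ᵥ θ)))) + 1 with hBdef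
    have hB : 0 < B := by positivity
    obtain ⟨n₀, hn₀, hsm⟩ := rho_small (min 1 (min (δ ^ 2 / B) ((ε / 6) / (32 * C3))))
      (lt_min one_pos (lt_min (by positivity) (by positivity)))
    refine ⟨m1 + r + n₀ + mS + mp + mc, n₀ + TS + Tp + Tc, ?_⟩
    intro m T hm hT
    have hmm : m1 ≤ m := by omega
    have hrm : r ≤ m := by omega
    have hm0 : 0 < m := lt_of_lt_of_le hr hrm
    have hT0 : 0 < T := by omega
    obtain ⟨a, ha, ha0, ha1, hbd⟩ := hcore m T hmm hrm hT0
    have hρs := hsm m T (by omega) (by omega)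
    have hρ0 : 0 < max (T : ℝ)⁻¹ (m : ℝ)⁻¹ := lt_max_of_lt_right (by positivity)
    have hTρ : (T : ℝ)⁻¹ ≤ max (T : ℝ)⁻¹ (m : ℝ)⁻¹ := le_max_left _ _
    have hmρ : (m : ℝ)⁻¹ ≤ max (T : ℝ)⁻¹ (m : ℝ)⁻¹ := le_max_right _ _
    set ρ0 : ℝ := max (T : ℝ)⁻¹ (m : ℝ)⁻¹ with hρ0def
    have hρ1 : ρ0 ≤ 1 := hρs.trans (min_le_left _ _)
    have hρδ : B * ρ0 ≤ δ ^ 2 := by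
      have := hρs.trans ((min_le_right _ _).trans (min_le_left _ _))
      rw [le_div_iff₀ hB] at this
      linarith
    have hρε : 32 * C3 * ρ0 ≤ ε / 6 := by
      have := hρs.trans ((min_le_right _ _).trans (min_le_right _ _))
      rw [le_div_iff₀ (by positivity)] at this
      linarith
    have hXd : ∀ t ω, Xmat m T t ω = Xdes (F m T (t - 1) ω) (y m T (t - 1) ω) := hXmat m T
    have hXhd : ∀ t ω, Xhat m T t ω = Xdes (Fhat m T (t - 1) ω) (y m T (t - 1) ω) := hXhat m T
    have E2 := rate_design hm0 hT0 a A0 K γ lam' MB ρ0 (ε / 6) hA0 hK hγ hlam0 hMB.le hρ0 hmρ hε6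
      ha ha0 ha1 (F m T) (Fhat m T) (Err m T) (V m T)
      (fun ω => sgnv ((V m T)ᵀ * Vhat m T ω)) (y m T) (ν m T) hbd (Xmat m T) (Xhat m T)
      hXd hXhd (hXm m T) (hEm m T hrm) (hIndep m T) hρε
    have avX := avg_mom (P := P m T) hT0 (fun t ω => fsq (Xmat m T t ω)) MB
      fun t ht => hXm m T t (Finset.mem_Icc.1 ht).1 (Finset.mem_Icc.1 ht).2
    have E4 := markov_lt (P := P m T)
      (fun ω => (T : ℝ)⁻¹ * ∑ t ∈ Finset.Icc 1 T, fsq (Xmat m T t ω)) avX.1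
      (fun ω => mul_nonneg (by positivity) (Finset.sum_nonneg fun t _ => fsq_nonneg _))
      MB C4 avX.2 hC4
    have hMC : MB / C4 = ε / 6 := by rw [hC4def]; field_simp
    rw [hMC] at E4
    have E5 := clt_tail (P := P m T) L e6 C5 he61 f hf0 hf1 hf2
      (fun ω => (Real.sqrt T)⁻¹ • ∑ t ∈ Finset.Icc 1 T, (Xmat m T t ω)ᵀ.mulVec (ν m T t ω))
      (hc m T (by omega) (by omega))
    refine union5 (P m T) _ _ _ _ _ _ ε hε ?_ (hS m T (by omega) (by omega)).le E2.le
      (hp m T (by omega) (by omega)).le E4 (E5.trans (ENNReal.ofReal_le_ofReal he62))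
    intro ω h1 h2 h3 h4 h5
    have h1' := not_not.1 fun h => h1 h
    refine fun hω => absurd (Set.mem_ofPred_eq.mp hω) (not_lt.2 ?_)
    exact det_bound hT0 (fun t => Xmat m T t ω) (fun t => Xhat m T t ω)
      (sgnv ((V m T)ᵀ * Vhat m T ω)) (sgnv_sq _) β ρ αc (θhat m T ω)
      (fun t => y m T t ω) (fun t => ν m T t ω) (fun t ht1 ht2 => hModel m T t ht1 ht2 ω)
      h1'.1 (hθhat m T ω) C1 L3 C4 nb C5 ρ0 δ hL3 hC4.le hnb hC5.le hρ0.le hρ1 hTρ hδ.le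
      h1'.2 (not_lt.1 fun h => h2 h) (not_lt.1 fun h => h4 h) (nu_bound hT0 (fun t => F m T t ω) (fun t => y m T t ω)
        (fun t => ν m T t ω) (fun t => Xmat m T t ω) (fun t => hXd t ω) SigXv (not_lt.1 fun h => h3 h)) (not_lt.1 fun h => h5 h) hρδ
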